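/- Let l_1, …, l_n be ℝ-linearly independent vectors in ℝ^n and let V ⊆ ℝ_{>0}^n × ℝ^m be a closed semialgebraic set. For ε_2, …, ε_n > 0 and 1 ≤ r ≤ n, let σ_r be the cone spanned by the vectors w_1 := l_1 and w_k := l_1 + Σ_{i=2}^{k} (∏_{j=2}^{i} ε_j) l_i for 2 ≤ k ≤ r. Then there exist (sufficiently small) ε_2, …, ε_n > 0 such that: (1) for all 1 ≤ s ≤ r ≤ n, L_{σ_r}(V) equals the relative limit set L_{σ_s, σ_r}(L_{σ_s}(V)); and (2) for all 1 ≤ r ≤ n and every strongly convex cone σ' ⊆ σ_r with relint(σ') ⊆ relint(σ_r), one has L_{σ'}(V) = (ρ_{σ',σ_r} × id_{ℝ^m})^{−1}(L_{σ_r}(V)), where ρ_{σ',σ_r} : O(σ')(ℝ_{>0}) → O(σ_r)(ℝ_{>0}) is the restriction map φ ↦ φ|_{σ_r^⊥}; in particular L_{σ'}(V) is the trivial ℝ_{>0}^{dim σ_r − dim σ'}-bundle over L_{σ_r}(V). -/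

import Mathlib

open Filter Topology

noncomputable section

/-- A closed semialgebraic subset of `ℝ^n × ℝ^m`: a finite union of sets of the form
`{x : p₁(x) ≥ 0, …, p_k(x) ≥ 0}` for real polynomials `p_i`. -/
def IsClosedSemialgebraic (n m : ℕ) (S : Set ((Fin n → ℝ) × (Fin m → ℝ))) : Prop :=
  ∃ (k : ℕ) (P : Fin k → Finset (MvPolynomial (Fin n ⊕ Fin m) ℝ)),
    S = ⋃ j : Fin k, {p | ∀ q ∈ P j, 0 ≤ MvPolynomial.eval (Sum.elim p.1 p.2) q}

/-- A closed semialgebraic subset of `ℝ_{>0}^n × ℝ^m`. -/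
def IsClosedSemialgebraicInOrthant (n m : ℕ) (V : Set ((Fin n → ℝ) × (Fin m → ℝ))) : Prop :=
  ∃ W, IsClosedSemialgebraic n m W ∧ V = {p | ∀ i, 0 < p.1 i} ∩ W

/-- The standard pairing of `ℝ^n` with its dual, both identified with `Fin n → ℝ`. -/
def dotR {n : ℕ} (w x : Fin n → ℝ) : ℝ := ∑ i, w i * x i

/-- `σ^⊥`: the annihilator of `σ` in the dual space. -/
def perpSet {n : ℕ} (σ : Set (Fin n → ℝ)) : Set (Fin n → ℝ) := {w | ∀ x ∈ σ, dotR w x = 0}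

/-- `σ^∨`: the dual cone of `σ`. -/
def dualSet {n : ℕ} (σ : Set (Fin n → ℝ)) : Set (Fin n → ℝ) := {w | ∀ x ∈ σ, 0 ≤ dotR w x}

/-- The monomial `x^w := ∏ᵢ xᵢ^{wᵢ}` (real exponents). -/
def mPow {n : ℕ} (x w : Fin n → ℝ) : ℝ := ∏ i, x i ^ w i

/-- The positive torus orbit `O(σ)(ℝ_{>0})`: functions `φ : σ^⊥ → ℝ_{>0}` of the form
`φ(w) = e^{ℓ(w)}` for an `ℝ`-linear functional `ℓ` on `σ^⊥` (represented by a vector `v`). -/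
def orbitSet {n : ℕ} (σ : Set (Fin n → ℝ)) : Set (↥(perpSet σ) → ℝ) :=
  {φ | ∃ v : Fin n → ℝ, ∀ w : ↥(perpSet σ), φ w = Real.exp (dotR v (w : Fin n → ℝ))}

/-- The limit set `L_σ(V) ⊆ O(σ)(ℝ_{>0}) × ℝ^m`: pairs `(φ, z)` with `φ` an orbit point,
such that some sequence `(x⁽ᵏ⁾, z⁽ᵏ⁾) ∈ V` has `z⁽ᵏ⁾ → z` and, for all `w ∈ σ^∨`,
`(x⁽ᵏ⁾)^w → φ(w)` if `w ∈ σ^⊥` and `(x⁽ᵏ⁾)^w → 0` if `w ∈ σ^∨ ∖ σ^⊥`. -/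
def limitSet {n : ℕ} (m : ℕ) (σ : Set (Fin n → ℝ))
    (V : Set ((Fin n → ℝ) × (Fin m → ℝ))) :
    Set ((↥(perpSet σ) → ℝ) × (Fin m → ℝ)) :=
  {p | p.1 ∈ orbitSet σ ∧
    ∃ u : ℕ → (Fin n → ℝ) × (Fin m → ℝ),
      (∀ k, u k ∈ V) ∧
      Tendsto (fun k => (u k).2) atTop (𝓝 p.2) ∧
      (∀ w (_hw : w ∈ dualSet σ) (hw' : w ∈ perpSet σ),
        Tendsto (fun k => mPow (u k).1 w) atTop (𝓝 (p.1 ⟨w, hw'⟩))) ∧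
      (∀ w, w ∈ dualSet σ → w ∉ perpSet σ →
        Tendsto (fun k => mPow (u k).1 w) atTop (𝓝 0))}

/-- The relative limit set `L_{σ,τ}(W) ⊆ O(τ)(ℝ_{>0}) × ℝ^m` of a subset
`W ⊆ O(σ)(ℝ_{>0}) × ℝ^m`, for cones `σ ⊆ τ`: pairs `(φ, z)` with `φ` an orbit point of
`τ`, such that some sequence `(ψ⁽ᵏ⁾, z⁽ᵏ⁾) ∈ W` has `z⁽ᵏ⁾ → z` and, for all
`w ∈ τ^∨ ∩ σ^⊥`, `ψ⁽ᵏ⁾(w) → φ(w)` if `w ∈ τ^⊥` and `ψ⁽ᵏ⁾(w) → 0` otherwise. -/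
def relLimitSet {n : ℕ} (m : ℕ) (σ τ : Set (Fin n → ℝ))
    (W : Set ((↥(perpSet σ) → ℝ) × (Fin m → ℝ))) :
    Set ((↥(perpSet τ) → ℝ) × (Fin m → ℝ)) :=
  {p | p.1 ∈ orbitSet τ ∧
    ∃ u : ℕ → (↥(perpSet σ) → ℝ) × (Fin m → ℝ),
      (∀ k, u k ∈ W) ∧
      Tendsto (fun k => (u k).2) atTop (𝓝 p.2) ∧
      (∀ w (_hw : w ∈ dualSet τ) (hwσ : w ∈ perpSet σ) (hwτ : w ∈ perpSet τ),
        Tendsto (fun k => (u k).1 ⟨w, hwσ⟩) atTop (𝓝 (p.1 ⟨w, hwτ⟩))) ∧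
      (∀ w (_hw : w ∈ dualSet τ) (hwσ : w ∈ perpSet σ), w ∉ perpSet τ →
        Tendsto (fun k => (u k).1 ⟨w, hwσ⟩) atTop (𝓝 0))}

/-- The restriction map `ρ_{σ',σ} : O(σ')(ℝ_{>0}) → O(σ)(ℝ_{>0})`, `φ ↦ φ|_{σ^⊥}`,
for `σ' ⊆ σ` (so that `σ^⊥ ⊆ σ'^⊥`). -/
def restrictOrbit {n : ℕ} (σ' σ : Set (Fin n → ℝ)) (h : σ' ⊆ σ)
    (φ : ↥(perpSet σ') → ℝ) : ↥(perpSet σ) → ℝ :=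
  fun w => φ ⟨(w : Fin n → ℝ), fun x hx => w.2 x (h hx)⟩

/-- A strongly convex closed convex cone: a closed convex cone (containing `0`) that
contains no line. It may be non-rational. -/
def IsSCCone {n : ℕ} (σ : Set (Fin n → ℝ)) : Prop :=
  IsClosed σ ∧ Convex ℝ σ ∧ (0 : Fin n → ℝ) ∈ σ ∧
    (∀ x ∈ σ, ∀ c : ℝ, 0 ≤ c → c • x ∈ σ) ∧ (∀ x ∈ σ, -x ∈ σ → x = 0)

/-- The vectors `w_k := l₁ + Σ_{i=2}^k (∏_{j=2}^i ε_j) l_i` (1-indexed `k`). -/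
def wVec {n : ℕ} (l : ℕ → Fin n → ℝ) (ε : ℕ → ℝ) (k : ℕ) : Fin n → ℝ :=
  l 1 + ∑ i ∈ Finset.Icc 2 k, (∏ j ∈ Finset.Icc 2 i, ε j) • l i

/-- The cone `σ_r` spanned by `w_1, …, w_r`. -/
def coneSigma (n : ℕ) (l : ℕ → Fin n → ℝ) (ε : ℕ → ℝ) (r : ℕ) : Set (Fin n → ℝ) :=
  {x | ∃ lam : ℕ → ℝ, (∀ k, 0 ≤ lam k) ∧ x = ∑ k ∈ Finset.Icc 1 r, lam k • wVec l ε k}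

open Polynomial in
/-- `y` and `y'` have the same position relative to the matched points of `I`. -/
def Compat (I : Finset (ℝ × ℝ)) (y y' : ℝ) : Prop :=
  ∀ p ∈ I, (p.1 < y ↔ p.2 < y') ∧ (y < p.1 ↔ y' < p.2)

def PIso (I : Finset (ℝ × ℝ)) : Prop := ∀ p ∈ I, Compat I p.1 p.2

theorem Compat.eq_iff {I : Finset (ℝ × ℝ)} {y y' : ℝ} (h : Compat I y y') {p : ℝ × ℝ}
    (hp : p ∈ I) : p.1 = y ↔ p.2 = y' := by
  have := h p hp
  constructor
  · intro h1
    by_contra h2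
    rcases lt_or_gt_of_ne h2 with h3 | h3
    · have := this.1.2 h3; linarith
    · have := this.2.2 h3; linarith
  · intro h1
    by_contra h2
    rcases lt_or_gt_of_ne h2 with h3 | h3
    · have := this.1.1 h3; linarith
    · have := this.2.1 h3; linarith

theorem exists_compat {I : Finset (ℝ × ℝ)} (hI : PIso I) (y : ℝ) : ∃ y', Compat I y y' := by
  obtain ⟨b, hb⟩ := Order.PartialIso.exists_across
    (⟨I, fun p hp q hq => by
      have h := hI q hq p hp
      rcases lt_trichotomy p.1 q.1 with h1 | h1 | h1
      · rw [cmp_eq_lt_iff _ _ |>.2 h1, cmp_eq_lt_iff _ _ |>.2 (h.1.1 h1)]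
      · rw [cmp_eq_eq_iff _ _ |>.2 h1, cmp_eq_eq_iff _ _ |>.2 (((hI q hq).eq_iff hp).1 h1)]
      · rw [cmp_eq_gt_iff _ _ |>.2 h1, cmp_eq_gt_iff _ _ |>.2 (h.2.1 h1)]⟩ :
      Order.PartialIso ℝ ℝ) y
  refine ⟨b, fun p hp => ?_⟩
  have := hb p hp
  constructor
  · rw [← cmp_eq_lt_iff, ← cmp_eq_lt_iff, this]
  · rw [← cmp_eq_gt_iff, ← cmp_eq_gt_iff, this]

def swapI (I : Finset (ℝ × ℝ)) : Finset (ℝ × ℝ) := I.image Prod.swap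

theorem mem_swapI {I : Finset (ℝ × ℝ)} {p : ℝ × ℝ} : p ∈ swapI I ↔ p.swap ∈ I := by
  unfold swapI
  rw [Finset.mem_image]
  constructor
  · rintro ⟨q, hq, rfl⟩; simpa using hq
  · intro h; exact ⟨p.swap, h, by simp⟩

theorem compat_swapI {I : Finset (ℝ × ℝ)} {y y' : ℝ} : Compat (swapI I) y' y ↔ Compat I y y' := by
  constructor
  · intro h p hp
    have := h p.swap (by rw [mem_swapI]; simpa using hp)
    exact ⟨this.1.symm, this.2.symm⟩
  · intro h p hp
    have := h p.swap (mem_swapI.1 hp)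
    exact ⟨this.1.symm, this.2.symm⟩

theorem PIso.swap {I : Finset (ℝ × ℝ)} (h : PIso I) : PIso (swapI I) := by
  intro p hp
  rw [compat_swapI]
  exact h p.swap (mem_swapI.1 hp)

theorem exists_compat' {I : Finset (ℝ × ℝ)} (hI : PIso I) (y' : ℝ) : ∃ y, Compat I y y' := by
  obtain ⟨y, hy⟩ := exists_compat hI.swap y'
  exact ⟨y, compat_swapI.1 hy⟩

theorem Compat.trans {I : Finset (ℝ × ℝ)} {y y' t x : ℝ} (h1 : Compat I y y') (h2 : Compat I y t)
    (h3 : Compat I x t) : Compat I x y' := by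
  intro p hp
  have a := h1 p hp
  have b := h2 p hp
  have c := h3 p hp
  exact ⟨c.1.trans (b.1.symm.trans a.1), c.2.trans (b.2.symm.trans a.2)⟩

theorem Compat.conv_right {I : Finset (ℝ × ℝ)} {y t1 t2 t : ℝ} (h1 : Compat I y t1)
    (h2 : Compat I y t2) (ht1 : t1 ≤ t) (ht2 : t ≤ t2) : Compat I y t := by
  intro p hp
  have a := h1 p hp
  have b := h2 p hp
  constructor
  · constructor
    · intro h; exact lt_of_lt_of_le (a.1.1 h) ht1
    · intro h; exact b.1.2 (lt_of_lt_of_le h ht2)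
  · constructor
    · intro h; exact lt_of_le_of_lt ht2 (b.2.1 h)
    · intro h; exact a.2.2 (lt_of_le_of_lt ht1 h)

theorem Compat.conv_left {I : Finset (ℝ × ℝ)} {y t1 t2 t : ℝ} (h1 : Compat I t1 y)
    (h2 : Compat I t2 y) (ht1 : t1 ≤ t) (ht2 : t ≤ t2) : Compat I t y := by
  rw [← compat_swapI] at *
  exact h1.conv_right h2 ht1 ht2

open Polynomial in
theorem left_neg {I : Finset (ℝ × ℝ)} {pa pb : ℝ[X]} {y y' : ℝ} (hI : PIso I)
    (hc : Compat I y y') (hy : ∀ p ∈ I, p.1 ≠ y)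
    (hda : ∀ x, Compat I x y' → 0 < pa.derivative.eval x)
    (hdb : ∀ x, Compat I y x → 0 < pb.derivative.eval x)
    (hs : ∀ p ∈ I, SignType.sign (pa.eval p.1) = SignType.sign (pb.eval p.2))
    (h0 : pa.eval y ≤ 0) : ∃ x, Compat I y x ∧ pb.eval x < 0 := by
  by_cases hL : (I.filter (fun p => p.1 < y)).Nonempty
  · obtain ⟨p, hp, hmax⟩ := Finset.exists_max_image _ (fun p => p.1) hL
    rw [Finset.mem_filter] at hp
    have hlt : pa.eval p.1 < pa.eval y := by
      have hmono : StrictMonoOn (fun x => pa.eval x) (Set.Icc p.1 y) := by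
        refine strictMonoOn_of_deriv_pos (convex_Icc _ _) pa.continuous.continuousOn ?_
        intro x hx
        rw [interior_Icc] at hx
        rw [Polynomial.deriv]
        apply hda
        intro q hq
        have h1 := hc q hq
        rcases lt_or_gt_of_ne (hy q hq) with h2 | h2
        · have := hmax q (Finset.mem_filter.2 ⟨hq, h2⟩)
          have h3 : q.1 < x := lt_of_le_of_lt this hx.1
          have h4 := h1.1.1 h2
          exact ⟨⟨fun _ => h4, fun _ => h3⟩, ⟨fun h => by linarith, fun h => by linarith⟩⟩
        · have h3 : x < q.1 := lt_trans hx.2 h2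
          have h4 := h1.2.1 h2
          exact ⟨⟨fun h => by linarith, fun h => by linarith⟩, ⟨fun _ => h4, fun _ => h3⟩⟩
      exact hmono ⟨le_refl _, hp.2.le⟩ ⟨hp.2.le, le_refl _⟩ hp.2
    have hneg : pb.eval p.2 < 0 := by
      rw [← sign_eq_neg_one_iff, ← hs p hp.1, sign_eq_neg_one_iff]
      linarith
    have hpy : p.2 < y' := (hc p hp.1).1.1 hp.2
    have hev : ∀ᶠ x in nhdsWithin p.2 (Set.Ioi p.2), pb.eval x < 0 :=
      (pb.continuous.continuousAt.eventually (gt_mem_nhds hneg)).filter_mono nhdsWithin_le_nhds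
    have hev2 : ∀ᶠ x in nhdsWithin p.2 (Set.Ioi p.2), x ∈ Set.Ioo p.2 y' :=
      Ioo_mem_nhdsGT hpy
    obtain ⟨x, hx1, hx2⟩ := (hev.and hev2).exists
    refine ⟨x, ?_, hx1⟩
    intro q hq
    have h1 := hc q hq
    rcases lt_or_gt_of_ne (hy q hq) with h2 | h2
    · have h3 := hmax q (Finset.mem_filter.2 ⟨hq, h2⟩)
      have h4 : q.2 ≤ p.2 := by
        by_contra h5
        have := (hI q hq p hp.1).1.2 (not_le.1 h5)
        linarith
      have h5 : q.2 < x := lt_of_le_of_lt h4 hx2.1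
      exact ⟨⟨fun _ => h5, fun _ => h2⟩, ⟨fun h => by linarith, fun h => by linarith⟩⟩
    · have h4 := h1.2.1 h2
      have h5 := hx2.2
      exact ⟨⟨fun h => by linarith, fun h => by linarith⟩, ⟨fun _ => by linarith, fun _ => h2⟩⟩
  · have hcell : ∀ x, x ≤ y' → Compat I y x := by
      intro x hx q hq
      have h1 := hc q hq
      rcases lt_or_gt_of_ne (hy q hq) with h2 | h2
      · exact absurd ⟨q, Finset.mem_filter.2 ⟨hq, h2⟩⟩ hL
      · have h4 := h1.2.1 h2
        exact ⟨⟨fun h => by linarith, fun h => by linarith⟩, ⟨fun _ => by linarith, fun _ => h2⟩⟩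
    by_contra hcon
    push Not at hcon
    have hmono : StrictMonoOn (fun x => pb.eval x) (Set.Iic y') := by
      refine strictMonoOn_of_deriv_pos (convex_Iic _) pb.continuous.continuousOn ?_
      intro x hx
      rw [interior_Iic] at hx
      rw [Polynomial.deriv]
      exact hdb _ (hcell x (le_of_lt hx))
    have hdeg : 0 < pb.degree := by
      by_contra hd
      have h1 := Polynomial.eq_C_of_degree_le_zero (not_lt.1 hd)
      have := hdb y' hc
      rw [h1] at this
      simp at this
    have hb := (Polynomial.abs_tendsto_atBot pb hdeg).eventually (eventually_gt_atTop (pb.eval y'))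
    obtain ⟨x, hx1, hx2⟩ := (hb.and (eventually_le_atBot y')).exists
    have h1 := hcon x (hcell x hx2)
    have h2 : pb.eval x ≤ pb.eval y' := hmono.monotoneOn hx2 (le_refl _ : y' ≤ y') hx2
    rw [abs_of_nonneg h1] at hx1
    linarith

open Polynomial in
theorem right_pos {I : Finset (ℝ × ℝ)} {pa pb : ℝ[X]} {y y' : ℝ} (hI : PIso I)
    (hc : Compat I y y') (hy : ∀ p ∈ I, p.1 ≠ y)
    (hda : ∀ x, Compat I x y' → 0 < pa.derivative.eval x)
    (hdb : ∀ x, Compat I y x → 0 < pb.derivative.eval x)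
    (hs : ∀ p ∈ I, SignType.sign (pa.eval p.1) = SignType.sign (pb.eval p.2))
    (h0 : 0 ≤ pa.eval y) : ∃ x, Compat I y x ∧ 0 < pb.eval x := by
  have key := @left_neg (I.image (fun p => (-p.1, -p.2))) (-(pa.comp (-X))) (-(pb.comp (-X)))
    (-y) (-y')
  have hcm : ∀ u v, Compat (I.image (fun p => (-p.1, -p.2))) u v ↔ Compat I (-u) (-v) := by
    intro u v
    constructor
    · intro h p hp
      have := h (-p.1, -p.2) (Finset.mem_image_of_mem _ hp)
      simp only at this
      rw [neg_lt, neg_lt (b := v), lt_neg, lt_neg (a := v)] at this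
      exact ⟨this.2, this.1⟩
    · intro h p hp
      obtain ⟨q, hq, rfl⟩ := Finset.mem_image.1 hp
      have := h q hq
      simp only
      rw [neg_lt, neg_lt (b := v), lt_neg, lt_neg (a := v)]
      exact ⟨this.2, this.1⟩
  have hIm : PIso (I.image (fun p => (-p.1, -p.2))) := by
    intro p hp
    rw [hcm]
    obtain ⟨q, hq, rfl⟩ := Finset.mem_image.1 hp
    simpa using hI q hq
  obtain ⟨x, hx1, hx2⟩ := key hIm (by rw [hcm]; simpa using hc)
    (by
      intro p hp
      obtain ⟨q, hq, rfl⟩ := Finset.mem_image.1 hp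
      simpa using hy q hq)
    (by
      intro x hx
      rw [hcm, neg_neg] at hx
      simpa [derivative_comp] using hda (-x) hx)
    (by
      intro x hx
      rw [hcm, neg_neg] at hx
      simpa [derivative_comp] using hdb (-x) hx)
    (by
      intro p hp
      obtain ⟨q, hq, rfl⟩ := Finset.mem_image.1 hp
      simpa [Left.sign_neg] using hs q hq)
    (by simpa using h0)
  refine ⟨-x, by rw [hcm, neg_neg] at hx1; exact hx1, by simpa using hx2⟩

open Polynomial in
theorem realize_pos {I : Finset (ℝ × ℝ)} {pa pb : ℝ[X]} {y y' : ℝ} (hI : PIso I)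
    (hc : Compat I y y') (hy : ∀ p ∈ I, p.1 ≠ y)
    (hda : ∀ x, Compat I x y' → 0 < pa.derivative.eval x)
    (hdb : ∀ x, Compat I y x → 0 < pb.derivative.eval x)
    (hs : ∀ p ∈ I, SignType.sign (pa.eval p.1) = SignType.sign (pb.eval p.2)) :
    ∃ x, Compat I y x ∧ SignType.sign (pb.eval x) = SignType.sign (pa.eval y) := by
  rcases lt_trichotomy (pa.eval y) 0 with h | h | h
  · obtain ⟨x, hx, hx2⟩ := left_neg hI hc hy hda hdb hs h.le
    exact ⟨x, hx, by rw [sign_neg h, sign_neg hx2]⟩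
  · obtain ⟨x, hx, hx2⟩ := left_neg hI hc hy hda hdb hs h.le
    obtain ⟨x', hx', hx2'⟩ := right_pos hI hc hy hda hdb hs h.ge
    have h0 : (0:ℝ) ∈ Set.uIcc (pb.eval x) (pb.eval x') := Set.mem_uIcc.2 (Or.inl ⟨hx2.le, hx2'.le⟩)
    obtain ⟨t, ht, ht0⟩ := intermediate_value_uIcc (f := fun x => pb.eval x)
      pb.continuous.continuousOn h0
    simp only at ht0
    refine ⟨t, ?_, by rw [ht0, h]⟩
    rcases Set.mem_uIcc.1 ht with ht | ht
    · exact hx.conv_right hx' ht.1 ht.2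
    · exact hx'.conv_right hx ht.1 ht.2
  · obtain ⟨x, hx, hx2⟩ := right_pos hI hc hy hda hdb hs h.le
    exact ⟨x, hx, by rw [sign_pos h, sign_pos hx2]⟩

open Polynomial in
/-- all the hypotheses of the one-step extension -/
structure StepHyp (I : Finset (ℝ × ℝ)) (pa pb : ℝ[X]) : Prop where
  hI : PIso I
  hd : ∀ y y', Compat I y y' →
    SignType.sign (pa.derivative.eval y) = SignType.sign (pb.derivative.eval y')
  hra : ∀ y, pa.derivative.eval y = 0 → ∃ p ∈ I, p.1 = y
  hrb : ∀ y, pb.derivative.eval y = 0 → ∃ p ∈ I, p.2 = y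
  hs : ∀ p ∈ I, SignType.sign (pa.eval p.1) = SignType.sign (pb.eval p.2)

open Polynomial in
theorem StepHyp.swap {I : Finset (ℝ × ℝ)} {pa pb : ℝ[X]} (h : StepHyp I pa pb) :
    StepHyp (swapI I) pb pa where
  hI := h.hI.swap
  hd y y' hy := (h.hd y' y (compat_swapI.1 hy)).symm
  hra y hy := by
    obtain ⟨p, hp, hp2⟩ := h.hrb y hy
    exact ⟨p.swap, by rw [mem_swapI]; simpa using hp, hp2⟩
  hrb y hy := by
    obtain ⟨p, hp, hp2⟩ := h.hra y hy
    exact ⟨p.swap, by rw [mem_swapI]; simpa using hp, hp2⟩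
  hs p hp := (h.hs p.swap (mem_swapI.1 hp)).symm

open Polynomial in
theorem StepHyp.neg {I : Finset (ℝ × ℝ)} {pa pb : ℝ[X]} (h : StepHyp I pa pb) :
    StepHyp I (-pa) (-pb) where
  hI := h.hI
  hd y y' hy := by simpa [Left.sign_neg] using h.hd y y' hy
  hra y hy := h.hra y (by simpa using hy)
  hrb y hy := h.hrb y (by simpa using hy)
  hs p hp := by simpa [Left.sign_neg] using h.hs p hp

open Polynomial in
theorem StepHyp.realize {I : Finset (ℝ × ℝ)} {pa pb : ℝ[X]} (h : StepHyp I pa pb) {y y' : ℝ}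
    (hc : Compat I y y') :
    ∃ x, Compat I y x ∧ SignType.sign (pb.eval x) = SignType.sign (pa.eval y) := by
  by_cases hy : ∃ p ∈ I, p.1 = y
  · obtain ⟨p, hp, rfl⟩ := hy
    exact ⟨p.2, h.hI p hp, (h.hs p hp).symm⟩
  · push Not at hy
    rcases lt_trichotomy (pa.derivative.eval y) 0 with h1 | h1 | h1
    · have hb : ∀ x, Compat I y x → pb.derivative.eval x < 0 := by
        intro x hx
        rw [← sign_eq_neg_one_iff, ← h.hd y x hx, sign_eq_neg_one_iff]; exact h1
      have ha : ∀ x, Compat I x y' → pa.derivative.eval x < 0 := by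
        intro x hx
        rw [← sign_eq_neg_one_iff, h.hd x y' hx, sign_eq_neg_one_iff]; exact hb _ hc
      obtain ⟨x, hx, hx2⟩ := realize_pos (pa := -pa) (pb := -pb) h.hI hc hy
        (by intro x hx; simpa using ha x hx) (by intro x hx; simpa using hb x hx) h.neg.hs
      exact ⟨x, hx, by simpa [Left.sign_neg] using hx2⟩
    · obtain ⟨p, hp, hp2⟩ := h.hra y h1
      exact absurd hp2 (hy p hp)
    · have hb : ∀ x, Compat I y x → 0 < pb.derivative.eval x := by
        intro x hx
        rw [← sign_eq_one_iff, ← h.hd y x hx, sign_eq_one_iff]; exact h1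
      have ha : ∀ x, Compat I x y' → 0 < pa.derivative.eval x := by
        intro x hx
        rw [← sign_eq_one_iff, h.hd x y' hx, sign_eq_one_iff]; exact hb _ hc
      exact realize_pos h.hI hc hy ha hb h.hs

open Polynomial in
theorem StepHyp.realize' {I : Finset (ℝ × ℝ)} {pa pb : ℝ[X]} (h : StepHyp I pa pb) {y y' : ℝ}
    (hc : Compat I y y') :
    ∃ x, Compat I x y' ∧ SignType.sign (pa.eval x) = SignType.sign (pb.eval y') := by
  obtain ⟨x, hx, hx2⟩ := h.swap.realize (compat_swapI.2 hc)
  exact ⟨x, compat_swapI.1 hx, hx2⟩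

open Polynomial in
theorem poly_mvt (p : ℝ[X]) {a b : ℝ} (h : a < b) :
    ∃ c ∈ Set.Ioo a b, p.derivative.eval c = (p.eval b - p.eval a) / (b - a) := by
  obtain ⟨c, hc, h1⟩ := exists_deriv_eq_slope (fun x => p.eval x) h p.continuous.continuousOn
    p.differentiable.differentiableOn
  rw [Polynomial.deriv] at h1
  exact ⟨c, hc, h1⟩

open Polynomial in
theorem poly_rolle (p : ℝ[X]) {a b : ℝ} (h : a < b) (ha : p.eval a = 0) (hb : p.eval b = 0) :
    ∃ c ∈ Set.Ioo a b, p.derivative.eval c = 0 := by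
  obtain ⟨c, hc, h1⟩ := poly_mvt p h
  exact ⟨c, hc, by rw [h1, ha, hb]; simp⟩

open Polynomial in
theorem StepHyp.noopp {I J : Finset (ℝ × ℝ)} {pa pb : ℝ[X]} (h : StepHyp I pa pb)
    (hIJ : I ⊆ J) (hJ : ∀ s t, pa.eval s = 0 → pb.eval t = 0 → Compat I s t → (s, t) ∈ J)
    {y y' : ℝ} (hc : Compat J y y') (h1 : pa.eval y < 0) (h2 : 0 < pb.eval y') : False := by
  have hc0 : Compat I y y' := fun p hp => hc p (hIJ hp)
  obtain ⟨x', hx', hx2⟩ := h.realize hc0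
  rw [sign_neg h1, sign_eq_neg_one_iff] at hx2
  obtain ⟨t, ht, ht0⟩ := intermediate_value_uIcc (f := fun x => pb.eval x) (a := x') (b := y')
      pb.continuous.continuousOn (Set.mem_uIcc.2 (Or.inl ⟨hx2.le, h2.le⟩))
  simp only at ht0
  have hyt : Compat I y t := by
    rcases Set.mem_uIcc.1 ht with ht | ht
    · exact hx'.conv_right hc0 ht.1 ht.2
    · exact hc0.conv_right hx' ht.1 ht.2
  obtain ⟨x, hx, hx0⟩ := h.realize' hyt
  rw [ht0, sign_zero, sign_eq_zero_iff] at hx0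
  have hxt := hc _ (hJ x t hx0 ht0 hx)
  simp only at hxt
  have hxy' : Compat I x y' := hc0.trans hyt hx
  rcases lt_trichotomy x y with h3 | h3 | h3
  · have h4 := hxt.1.1 h3
    obtain ⟨c, hc1, hc2⟩ := poly_mvt pa h3
    obtain ⟨d, hd1, hd2⟩ := poly_mvt pb h4
    have e1 : pa.derivative.eval c < 0 := by
      rw [hc2, hx0]; apply div_neg_of_neg_of_pos <;> linarith
    have e2 : 0 < pb.derivative.eval d := by
      rw [hd2, ht0]; apply div_pos <;> linarith
    have hcc : Compat I c t := hx.conv_left hyt hc1.1.le hc1.2.le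
    have hdd : Compat I y d := hyt.conv_right hc0 hd1.1.le hd1.2.le
    have := h.hd c d (hdd.trans hyt hcc)
    rw [sign_neg e1, sign_pos e2] at this
    exact absurd this (by decide)
  · rw [h3] at hx0; linarith
  · have h4 := hxt.2.1 h3
    obtain ⟨c, hc1, hc2⟩ := poly_mvt pa h3
    obtain ⟨d, hd1, hd2⟩ := poly_mvt pb h4
    have e1 : 0 < pa.derivative.eval c := by
      rw [hc2, hx0]; apply div_pos <;> linarith
    have e2 : pb.derivative.eval d < 0 := by
      rw [hd2, ht0]; apply div_neg_of_neg_of_pos <;> linarith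
    have hcc : Compat I c t := hyt.conv_left hx hc1.1.le hc1.2.le
    have hdd : Compat I y d := hc0.conv_right hyt hd1.1.le hd1.2.le
    have := h.hd c d (hdd.trans hyt hcc)
    rw [sign_neg e2, sign_pos e1] at this
    exact absurd this (by decide)

open Polynomial in
theorem StepHyp.extend {I : Finset (ℝ × ℝ)} {pa pb : ℝ[X]} (h : StepHyp I pa pb)
    (ha : pa ≠ 0) (hb : pb ≠ 0) :
    ∃ J, I ⊆ J ∧ PIso J ∧ ∀ y y', Compat J y y' →
      SignType.sign (pa.eval y) = SignType.sign (pb.eval y') := by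
  classical
  let N := (pa.roots.toFinset ×ˢ pb.roots.toFinset).filter (fun p => Compat I p.1 p.2)
  have hN : ∀ p, p ∈ N ↔ (pa.eval p.1 = 0 ∧ pb.eval p.2 = 0) ∧ Compat I p.1 p.2 := by
    intro p
    simp [N, ha, hb]
  have hJ : ∀ s t, pa.eval s = 0 → pb.eval t = 0 → Compat I s t → (s, t) ∈ I ∪ N := by
    intro s t h1 h2 h3
    exact Finset.mem_union_right _ ((hN _).2 ⟨⟨h1, h2⟩, h3⟩)
  refine ⟨I ∪ N, Finset.subset_union_left, ?_, ?_⟩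
  · have half : ∀ p ∈ N, ∀ q ∈ N, (p.1 < q.1 ↔ p.2 < q.2) := by
      intro p hp q hq
      rw [hN] at hp hq
      constructor
      · intro hlt
        obtain ⟨c, hc, hc0⟩ := poly_rolle pa hlt hp.1.1 hq.1.1
        obtain ⟨r, hr, rfl⟩ := h.hra c hc0
        exact ((hp.2 r hr).2.1 hc.1).trans ((hq.2 r hr).1.1 hc.2)
      · intro hlt
        obtain ⟨c, hc, hc0⟩ := poly_rolle pb hlt hp.1.2 hq.1.2
        obtain ⟨r, hr, rfl⟩ := h.hrb c hc0
        exact ((hp.2 r hr).2.2 hc.1).trans ((hq.2 r hr).1.2 hc.2)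
    intro p hp q hq
    rcases Finset.mem_union.1 hp with hp | hp
    · rcases Finset.mem_union.1 hq with hq | hq
      · exact h.hI p hp q hq
      · have := ((hN q).1 hq).2 p hp
        exact ⟨this.2, this.1⟩
    · rcases Finset.mem_union.1 hq with hq | hq
      · exact ((hN p).1 hp).2 q hq
      · exact ⟨half q hq p hp, half p hp q hq⟩
  · intro y y' hc
    have hc0 : Compat I y y' := fun p hp => hc p (Finset.mem_union_left _ hp)
    by_cases hy0 : pa.eval y = 0
    · obtain ⟨x', hx', hx2⟩ := h.realize hc0
      rw [hy0, sign_zero, sign_eq_zero_iff] at hx2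
      have := (hc.eq_iff (hJ y x' hy0 hx2 hx')).1 rfl
      simp only at this
      rw [hy0, ← this, hx2]
    by_cases hy0' : pb.eval y' = 0
    · obtain ⟨x, hx, hx2⟩ := h.realize' hc0
      rw [hy0', sign_zero, sign_eq_zero_iff] at hx2
      have := (hc.eq_iff (hJ x y' hx2 hy0' hx)).2 rfl
      simp only at this
      rw [hy0', ← this, hx2]
    rcases lt_or_gt_of_ne hy0 with h1 | h1
    · rcases lt_or_gt_of_ne hy0' with h2 | h2
      · rw [sign_neg h1, sign_neg h2]
      · exact (h.noopp Finset.subset_union_left hJ hc h1 h2).elim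
    · rcases lt_or_gt_of_ne hy0' with h2 | h2
      · exact (h.neg.noopp Finset.subset_union_left
          (fun s t h1 h2 => hJ s t (by simpa using h1) (by simpa using h2)) hc
          (by simpa using h1) (by simpa using h2)).elim
      · rw [sign_pos h1, sign_pos h2]

open Polynomial in
/-- restrict a good partial isomorphism to the roots -/
theorem restrict_good {ι : Type*} (B : Set ι) (fa fb : ι → ℝ[X]) {I : Finset (ℝ × ℝ)}
    (hI : PIso I) (h0 : ∀ i ∈ B, fa i = 0 ↔ fb i = 0)
    (hg : ∀ y y', Compat I y y' → ∀ i ∈ B,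
      SignType.sign ((fa i).eval y) = SignType.sign ((fb i).eval y')) :
    ∃ J, J ⊆ I ∧ PIso J ∧
      (∀ y y', Compat J y y' → ∀ i ∈ B,
        SignType.sign ((fa i).eval y) = SignType.sign ((fb i).eval y')) ∧
      (∀ i ∈ B, fa i ≠ 0 → ∀ y, (fa i).eval y = 0 → ∃ p ∈ J, p.1 = y) ∧
      (∀ i ∈ B, fb i ≠ 0 → ∀ y, (fb i).eval y = 0 → ∃ p ∈ J, p.2 = y) ∧
      (∀ p ∈ J, ∃ i ∈ B, fa i ≠ 0 ∧ (fa i).eval p.1 = 0) := by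
  classical
  let J := I.filter (fun p => ∃ i ∈ B, fa i ≠ 0 ∧ (fa i).eval p.1 = 0)
  have hJI : J ⊆ I := Finset.filter_subset _ _
  -- roots on the `b` side belong to `I`
  have hb : ∀ i ∈ B, fb i ≠ 0 → ∀ y, (fb i).eval y = 0 → ∃ p ∈ J, p.2 = y := by
    intro i hi hne t ht
    obtain ⟨s, hs⟩ := exists_compat' hI t
    have hs0 : (fa i).eval s = 0 := by
      rw [← sign_eq_zero_iff, hg s t hs i hi, ht, sign_zero]
    by_contra hcon
    push Not at hcon
    have hnI : ∀ p ∈ I, p.2 ≠ t := by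
      intro p hp hpt
      have h1 := (hs.eq_iff hp).2 hpt
      exact hcon p (Finset.mem_filter.2 ⟨hp, i, hi, fun h => hne ((h0 i hi).1 h), by rw [h1, hs0]⟩)
        hpt
    have hev : ∀ᶠ x in nhds t, Compat I s x := by
      have : ∀ p ∈ I, ∀ᶠ x in nhds t, (p.1 < s ↔ p.2 < x) ∧ (s < p.1 ↔ x < p.2) := by
        intro p hp
        have h1 := hs p hp
        rcases lt_or_gt_of_ne (hnI p hp) with h2 | h2
        · filter_upwards [lt_mem_nhds h2] with x hx
          have h3 := h1.1.2 h2
          exact ⟨⟨fun _ => hx, fun _ => h3⟩, ⟨fun h => by linarith, fun h => by linarith⟩⟩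
        · filter_upwards [gt_mem_nhds h2] with x hx
          have h3 := h1.2.2 h2
          exact ⟨⟨fun h => by linarith, fun h => by linarith⟩, ⟨fun _ => hx, fun _ => h3⟩⟩
      have := (Filter.eventually_all_finset I).2 this
      exact this
    have hz : ∀ᶠ x in nhds t, (fb i).eval x = 0 := by
      filter_upwards [hev] with x hx
      rw [← sign_eq_zero_iff, ← hg s x hx i hi, hs0, sign_zero]
    apply hne
    apply Polynomial.eq_zero_of_infinite_isRoot
    exact infinite_of_mem_nhds t hz
  have ha : ∀ i ∈ B, fa i ≠ 0 → ∀ y, (fa i).eval y = 0 → ∃ p ∈ J, p.1 = y := by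
    intro i hi hne s hs
    obtain ⟨t, ht⟩ := exists_compat hI s
    have ht0 : (fb i).eval t = 0 := by
      rw [← sign_eq_zero_iff, ← hg s t ht i hi, hs, sign_zero]
    obtain ⟨p, hp, hpt⟩ := hb i hi (fun h => hne ((h0 i hi).2 h)) t ht0
    exact ⟨p, hp, (ht.eq_iff (hJI hp)).2 hpt⟩
  refine ⟨J, hJI, fun p hp q hq => hI p (hJI hp) q (hJI hq), ?_, ha, hb,
    fun p hp => (Finset.mem_filter.1 hp).2⟩
  intro y y' hc i hi
  obtain ⟨y2, hy2⟩ := exists_compat hI y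
  rw [hg y y2 hy2 i hi]
  have hc2 : Compat J y y2 := fun p hp => hy2 p (hJI hp)
  by_cases hz : fb i = 0
  · simp [hz]
  by_contra hcon
  -- there is a root between
  have hroot : ∃ t ∈ Set.uIcc y2 y', (fb i).eval t = 0 := by
    have : (0:ℝ) ∈ Set.uIcc ((fb i).eval y2) ((fb i).eval y') := by
      rw [Set.mem_uIcc]
      rcases lt_trichotomy ((fb i).eval y2) 0 with h1 | h1 | h1
      · rcases lt_or_ge ((fb i).eval y') 0 with h2 | h2
        · rw [sign_neg h1, sign_neg h2] at hcon; exact absurd rfl hcon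
        · exact Or.inl ⟨h1.le, h2⟩
      · rw [h1]
        rcases le_total ((fb i).eval y') 0 with h2 | h2
        · exact Or.inr ⟨h2, le_refl _⟩
        · exact Or.inl ⟨le_refl _, h2⟩
      · rcases lt_or_ge 0 ((fb i).eval y') with h2 | h2
        · rw [sign_pos h1, sign_pos h2] at hcon; exact absurd rfl hcon
        · exact Or.inr ⟨h2, h1.le⟩
    exact intermediate_value_uIcc (f := fun x => (fb i).eval x) (fb i).continuous.continuousOn this
  obtain ⟨t, ht, ht0⟩ := hroot
  obtain ⟨p, hp, hpt⟩ := hb i hi hz t ht0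
  have hyt : Compat J y t := by
    rcases Set.mem_uIcc.1 ht with ht | ht
    · exact hc2.conv_right hc ht.1 ht.2
    · exact hc.conv_right hc2 ht.1 ht.2
  have h1 := (hyt.eq_iff hp).2 hpt
  have h2 := (hc.eq_iff hp).1 h1
  have h3 := (hc2.eq_iff hp).1 h1
  exact hcon (by rw [← h2, ← h3])

open Polynomial in
theorem pseudo_rem {R : Type*} [CommRing R] (g : R[X]) (j : ℕ) (hj : 1 ≤ j) (hg : g.natDegree ≤ j) :
    ∀ (N : ℕ) (p : R[X]), p.natDegree ≤ N →
      ∃ (k : ℕ) (s r : R[X]), C (g.coeff j) ^ k * p = g * s + r ∧ r.natDegree < j := by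
  intro N
  induction N with
  | zero =>
    intro p hp
    exact ⟨0, 0, p, by simp, by omega⟩
  | succ N ih =>
    intro p hp
    by_cases hlt : p.natDegree < j
    · exact ⟨0, 0, p, by simp, hlt⟩
    by_cases hN : N + 1 < j
    · omega
    have hp1 : (C (g.coeff j) * p - g * (C (p.coeff (N+1)) * X ^ (N + 1 - j))).natDegree ≤ N := by
      have hle : (C (g.coeff j) * p - g * (C (p.coeff (N+1)) * X ^ (N + 1 - j))).natDegree
          ≤ N + 1 := by
        refine (natDegree_sub_le _ _).trans (max_le ((natDegree_C_mul_le _ _).trans hp) ?_)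
        refine natDegree_mul_le.trans ?_
        have : (C (p.coeff (N+1)) * X ^ (N + 1 - j)).natDegree ≤ N + 1 - j :=
          natDegree_C_mul_X_pow_le _ _
        omega
      by_contra hcon
      have heq : (C (g.coeff j) * p - g * (C (p.coeff (N+1)) * X ^ (N + 1 - j))).natDegree
          = N + 1 := by omega
      have hc : (C (g.coeff j) * p - g * (C (p.coeff (N+1)) * X ^ (N + 1 - j))).coeff (N+1) = 0 := by
        rw [coeff_sub, coeff_C_mul, ← mul_assoc, coeff_mul_X_pow', if_pos (by omega), coeff_mul_C]
        have : N + 1 - (N + 1 - j) = j := by omega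
        rw [this]; ring
      have h2 : (C (g.coeff j) * p - g * (C (p.coeff (N+1)) * X ^ (N + 1 - j))) = 0 := by
        rw [← leadingCoeff_eq_zero, leadingCoeff, heq, hc]
      rw [h2] at heq
      simp at heq
    obtain ⟨k, s, r, h1, h2⟩ := ih _ hp1
    refine ⟨k + 1, s + C (g.coeff j) ^ k * (C (p.coeff (N+1)) * X ^ (N + 1 - j)), r, ?_, h2⟩
    linear_combination h1

open Polynomial in
/-- the truncation of `q` in degrees `≤ j` -/
def truncP {R : Type*} [CommRing R] (q : R[X]) (j : ℕ) : R[X] :=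
  ∑ i ∈ Finset.range (j + 1), C (q.coeff i) * X ^ i

open Polynomial in
theorem truncP_coeff {R : Type*} [CommRing R] (q : R[X]) (j i : ℕ) :
    (truncP q j).coeff i = if i ≤ j then q.coeff i else 0 := by
  unfold truncP
  rw [finsetSum_coeff]
  simp only [coeff_C_mul, coeff_X_pow, mul_ite, mul_one, mul_zero]
  rw [Finset.sum_ite_eq]
  simp

open Polynomial in
theorem truncP_natDegree {R : Type*} [CommRing R] (q : R[X]) (j : ℕ) :
    (truncP q j).natDegree ≤ j := by
  rw [natDegree_le_iff_coeff_eq_zero]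
  intro i hi
  rw [truncP_coeff, if_neg (by omega)]

open Polynomial in
/-- The sign diagrams of the families `P_a` and `P_b` agree. -/
def SameDiag {R : Type*} [CommRing R] (P : Set R[X]) (a b : R →+* ℝ) : Prop :=
  ∃ I, PIso I ∧ ∀ y y', Compat I y y' → ∀ q ∈ P,
    SignType.sign ((q.map a).eval y) = SignType.sign ((q.map b).eval y')

open Polynomial in
def Elim {R : Type*} [CommRing R] (P : Set R[X]) : Prop :=
  ∃ Q : Finset R, ∀ a b : R →+* ℝ,
    (∀ q ∈ Q, SignType.sign (a q) = SignType.sign (b q)) → SameDiag P a b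

theorem sign_zero_iff_of_eq {x y : ℝ} (h : SignType.sign x = SignType.sign y) : x = 0 ↔ y = 0 := by
  rw [← sign_eq_zero_iff, h, sign_eq_zero_iff]

open Polynomial in
theorem Elim.mono {R : Type*} [CommRing R] {P P' : Set R[X]} (h : P' ⊆ P) (hP : Elim P) :
    Elim P' := by
  obtain ⟨Q, hQ⟩ := hP
  refine ⟨Q, fun a b hab => ?_⟩
  obtain ⟨I, hI, h2⟩ := hQ a b hab
  exact ⟨I, hI, fun y y' hc q hq => h2 y y' hc q (h hq)⟩

open Polynomial in
/-- the core step -/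
theorem elim_step {R : Type*} [CommRing R] (D : ℕ) (hD : 1 ≤ D) (p : R[X]) (hp : p.natDegree = D)
    (T L : Finset R[X]) (hT : ∀ q ∈ T, q.natDegree = D) (hL : ∀ q ∈ L, q.natDegree < D)
    (ih : ∀ L' : Finset R[X], (∀ q ∈ L', q.natDegree < D) → Elim (T ∪ L' : Set R[X])) :
    Elim (insert p T ∪ L : Set R[X]) := by
  classical
  -- case 1 : leading coefficient vanishes
  obtain ⟨Q1, hQ1⟩ := ih (insert p.eraseLead L) (by
    intro q hq
    rcases Finset.mem_insert.1 hq with rfl | hq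
    · have := eraseLead_natDegree_le p
      omega
    · exact hL q hq)
  -- the remainders
  have hrem : ∀ (q : R[X]) (j : ℕ), ∃ (k : ℕ) (s r : R[X]), 1 ≤ j →
      C ((truncP q j).coeff j) ^ k * p = truncP q j * s + r ∧ r.natDegree < j := by
    intro q j
    by_cases hj : 1 ≤ j
    · obtain ⟨k, s, r, h⟩ := pseudo_rem (truncP q j) j hj (truncP_natDegree q j) _ p le_rfl
      exact ⟨k, s, r, fun _ => h⟩
    · exact ⟨0, 0, 0, fun h => absurd h hj⟩
  choose kk ss rr hrr using hrem
  let B : Finset R[X] := insert p.derivative (T ∪ L)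
  have hBd : ∀ q ∈ B, q.natDegree ≤ D := by
    intro q hq
    rcases Finset.mem_insert.1 hq with rfl | hq
    · have := natDegree_derivative_le p
      omega
    · rcases Finset.mem_union.1 hq with hq | hq
      · exact (hT q hq).le
      · exact (hL q hq).le
  let rems : Finset R[X] := (B ×ˢ Finset.Icc 1 D).image (fun x => rr x.1 x.2)
  obtain ⟨Q2, hQ2⟩ := ih (insert p.derivative (L ∪ rems)) (by
    intro q hq
    rcases Finset.mem_insert.1 hq with rfl | hq
    · have := natDegree_derivative_le p
      omega
    · rcases Finset.mem_union.1 hq with hq | hq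
      · exact hL q hq
      · obtain ⟨x, hx, rfl⟩ := Finset.mem_image.1 hq
        rw [Finset.mem_product, Finset.mem_Icc] at hx
        have := (hrr x.1 x.2 hx.2.1).2
        omega)
  let Q3 : Finset R := (B ×ˢ Finset.range (D + 1)).image (fun x => x.1.coeff x.2)
  refine ⟨insert p.leadingCoeff (Q1 ∪ Q2 ∪ Q3), fun a b hab => ?_⟩
  have hlc := hab p.leadingCoeff (Finset.mem_insert_self _ _)
  have hab1 : ∀ q ∈ Q1, SignType.sign (a q) = SignType.sign (b q) := fun q hq =>
    hab q (by simp [hq])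
  have hab2 : ∀ q ∈ Q2, SignType.sign (a q) = SignType.sign (b q) := fun q hq =>
    hab q (by simp [hq])
  have hab3 : ∀ q ∈ B, ∀ i, SignType.sign (a (q.coeff i)) = SignType.sign (b (q.coeff i)) := by
    intro q hq i
    by_cases hi : i ≤ D
    · apply hab
      apply Finset.mem_insert_of_mem
      apply Finset.mem_union_right
      exact Finset.mem_image.2 ⟨(q, i), Finset.mem_product.2 ⟨hq, Finset.mem_range.2 (by omega)⟩, rfl⟩
    · rw [coeff_eq_zero_of_natDegree_lt (by have := hBd q hq; omega)]
      simp
  by_cases hza : a p.leadingCoeff = 0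
  · have hzb : b p.leadingCoeff = 0 := (sign_zero_iff_of_eq hlc).1 hza
    obtain ⟨I, hI, h2⟩ := hQ1 a b hab1
    refine ⟨I, hI, fun y y' hc q hq => ?_⟩
    rcases hq with hq | hq
    · rcases hq with rfl | hq
      · have ea : q.map a = q.eraseLead.map a := by
          have h := congrArg (Polynomial.map a) (eraseLead_add_monomial_natDegree_leadingCoeff q)
          rw [Polynomial.map_add, map_monomial, hza, monomial_zero_right, add_zero] at h
          exact h.symm
        have eb : q.map b = q.eraseLead.map b := by
          have h := congrArg (Polynomial.map b) (eraseLead_add_monomial_natDegree_leadingCoeff q)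
          rw [Polynomial.map_add, map_monomial, hzb, monomial_zero_right, add_zero] at h
          exact h.symm
        rw [ea, eb]
        exact h2 y y' hc _ (by simp)
      · exact h2 y y' hc _ (Or.inl hq)
    · exact h2 y y' hc _ (Or.inr (by simp at hq ⊢; exact Or.inr hq))
  · have hzb : b p.leadingCoeff ≠ 0 := fun h => hza ((sign_zero_iff_of_eq hlc).2 h)
    obtain ⟨I, hI, h2⟩ := hQ2 a b hab2
    have hB0 : ∀ q ∈ B, q.map a = 0 ↔ q.map b = 0 := by
      intro q hq
      rw [Polynomial.ext_iff, Polynomial.ext_iff]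
      apply forall_congr'
      intro i
      rw [coeff_map, coeff_map, coeff_zero]
      exact sign_zero_iff_of_eq (hab3 q hq i)
    have hBmem : ∀ q ∈ B, q ∈ (T ∪ (insert p.derivative (L ∪ rems) : Finset R[X]) : Set R[X]) := by
      intro q hq
      rcases Finset.mem_insert.1 hq with rfl | hq
      · right; simp
      · rcases Finset.mem_union.1 hq with hq | hq
        · exact Or.inl hq
        · right; simp [hq]
    obtain ⟨J, hJI, hJ, hJg, hJa, hJb, hJr⟩ := restrict_good (B : Set R[X]) (fun q => q.map a)
      (fun q => q.map b) hI hB0 (fun y y' hc q hq => h2 y y' hc q (hBmem q hq))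
    have hda : (p.map a).natDegree = D := by
      rw [natDegree_map_of_leadingCoeff_ne_zero a hza, hp]
    have hdb : (p.map b).natDegree = D := by
      rw [natDegree_map_of_leadingCoeff_ne_zero b hzb, hp]
    have hpB : p.derivative ∈ B := Finset.mem_insert_self _ _
    have hderne : ∀ (f : ℝ[X]), f.natDegree = D → f.derivative ≠ 0 := by
      intro f hf h0
      have := derivative_eq_zero.1 h0
      omega
    have hstep : StepHyp J (p.map a) (p.map b) := by
      refine ⟨hJ, ?_, ?_, ?_, ?_⟩
      · intro y y' hc
        have := hJg y y' hc p.derivative hpB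
        simpa [derivative_map] using this
      · intro y hy
        rw [derivative_map] at hy
        exact hJa p.derivative hpB (by rw [← derivative_map]; exact hderne _ hda) y hy
      · intro y hy
        rw [derivative_map] at hy
        exact hJb p.derivative hpB (by rw [← derivative_map]; exact hderne _ hdb) y hy
      · intro x hx
        obtain ⟨q, hq, hq0, hqx⟩ := hJr x hx
        have hqx' : (q.map b).eval x.2 = 0 := by
          have := hJg x.1 x.2 (hJ x hx) q hq
          rw [hqx, sign_zero, eq_comm, sign_eq_zero_iff] at this
          exact this
        set j := (q.map a).natDegree with hj
        have hjb : (q.map b).natDegree = j := by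
          apply le_antisymm
          · rw [natDegree_le_iff_coeff_eq_zero]
            intro i hi
            rw [coeff_map, ← sign_zero_iff_of_eq (hab3 q hq i), ← coeff_map]
            exact coeff_eq_zero_of_natDegree_lt hi
          · rw [hj, natDegree_le_iff_coeff_eq_zero]
            intro i hi
            rw [coeff_map, sign_zero_iff_of_eq (hab3 q hq i), ← coeff_map]
            exact coeff_eq_zero_of_natDegree_lt hi
        have hj1 : 1 ≤ j := by
          by_contra hcon
          have h0 : (q.map a).natDegree = 0 := by omega
          rw [natDegree_eq_zero] at h0
          obtain ⟨c, hc⟩ := h0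
          rw [← hc, eval_C] at hqx
          rw [← hc, hqx] at hq0
          simp at hq0
        have hjD : j ≤ D := natDegree_map_le.trans (hBd q hq)
        have hta : (truncP q j).map a = q.map a := by
          ext i
          rw [coeff_map, truncP_coeff]
          split_ifs with hi
          · rw [coeff_map]
          · rw [coeff_eq_zero_of_natDegree_lt (p := q.map a) (by omega)]; simp
        have htb : (truncP q j).map b = q.map b := by
          ext i
          rw [coeff_map, truncP_coeff]
          split_ifs with hi
          · rw [coeff_map]
          · rw [coeff_eq_zero_of_natDegree_lt (p := q.map b) (by omega)]; simp
        have hid := (hrr q j hj1).1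
        rw [truncP_coeff, if_pos le_rfl] at hid
        have hla : a (q.coeff j) ≠ 0 := by
          rw [← coeff_map]
          exact leadingCoeff_ne_zero.2 hq0
        have hidl := congrArg (fun f => (f.map a).eval x.1) hid
        have hidr := congrArg (fun f => (f.map b).eval x.2) hid
        simp only [Polynomial.map_mul, Polynomial.map_add, Polynomial.map_pow, hta, htb, map_C,
          eval_mul, eval_add, eval_pow, eval_C, hqx, hqx', zero_mul, zero_add] at hidl hidr
        have hr := h2 x.1 x.2 (hI x (hJI hx)) (rr q j) (by
          right
          have : rr q j ∈ rems := Finset.mem_image.2 ⟨(q, j), Finset.mem_product.2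
            ⟨hq, Finset.mem_Icc.2 ⟨hj1, hjD⟩⟩, rfl⟩
          simp [this])
        rw [← hidl, ← hidr, sign_mul, sign_mul, sign_pow, sign_pow, ← hab3 q hq j] at hr
        have hne : SignType.sign (a (q.coeff j)) ^ kk q j ≠ 0 :=
          pow_ne_zero _ (by rwa [Ne, sign_eq_zero_iff])
        exact mul_left_cancel₀ hne hr
    obtain ⟨K, hJK, hK, hKg⟩ := hstep.extend
      (by intro h; rw [h] at hda; simp at hda; omega)
      (by intro h; rw [h] at hdb; simp at hdb; omega)
    refine ⟨K, hK, fun y y' hc q hq => ?_⟩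
    have hcJ : Compat J y y' := fun x hx => hc x (hJK hx)
    rcases hq with hq | hq
    · rcases hq with rfl | hq
      · exact hKg y y' hc
      · exact hJg y y' hcJ q (by simp [B]; exact Or.inr (Or.inl hq))
    · exact hJg y y' hcJ q (by simp [B]; exact Or.inr (Or.inr hq))

open Polynomial in
theorem elim_level {R : Type*} [CommRing R] (D : ℕ)
    (base : ∀ L : Finset R[X], (∀ q ∈ L, q.natDegree < D) → Elim (L : Set R[X]))
    (T : Finset R[X]) : (∀ q ∈ T, q.natDegree = D) →
      ∀ L : Finset R[X], (∀ q ∈ L, q.natDegree < D) → Elim (T ∪ L : Set R[X]) := by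
  classical
  induction T using Finset.induction_on with
  | empty => intro _ L hL; simpa using base L hL
  | insert p T hpT ih =>
    intro hT L hL
    have hp := hT p (Finset.mem_insert_self _ _)
    have hT' : ∀ q ∈ T, q.natDegree = D := fun q hq => hT q (Finset.mem_insert_of_mem hq)
    rw [Finset.coe_insert]
    rcases Nat.eq_zero_or_pos D with hD | hD
    · obtain ⟨Q, hQ⟩ := ih hT' L hL
      refine ⟨insert (p.coeff 0) Q, fun a b hab => ?_⟩
      obtain ⟨I, hI, h2⟩ := hQ a b (fun q hq => hab q (Finset.mem_insert_of_mem hq))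
      refine ⟨I, hI, fun y y' hc q hq => ?_⟩
      rcases hq with hq | hq
      · rcases hq with rfl | hq
        · rw [eq_C_of_natDegree_eq_zero (hp.trans hD)]
          simp only [map_C, eval_C]
          exact hab _ (Finset.mem_insert_self _ _)
        · exact h2 y y' hc q (Or.inl hq)
      · exact h2 y y' hc q (Or.inr hq)
    · exact elim_step D hD p hp T L hT' hL (ih hT')

open Polynomial in
theorem elim_all {R : Type*} [CommRing R] (D : ℕ) :
    ∀ P : Finset R[X], (∀ q ∈ P, q.natDegree < D) → Elim (P : Set R[X]) := by
  classical
  induction D with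
  | zero =>
    intro P hP
    refine ⟨∅, fun a b _ => ⟨∅, by intro p hp; simp at hp, fun y y' _ q hq => ?_⟩⟩
    exact absurd (hP q hq) (by omega)
  | succ D ih =>
    intro P hP
    have := elim_level D ih (P.filter (fun q => q.natDegree = D)) (by simp)
      (P.filter (fun q => q.natDegree < D)) (by simp)
    refine this.mono ?_
    intro q hq
    have := hP q hq
    rcases Nat.lt_or_ge q.natDegree D with h | h
    · right; simp [h]; exact hq
    · left; simp; exact ⟨hq, by omega⟩

open Polynomial in
theorem elim_finset {R : Type*} [CommRing R] (P : Finset R[X]) : Elim (P : Set R[X]) :=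
  elim_all (P.sup (fun q => q.natDegree) + 1) P (fun q hq => Nat.lt_succ_of_le
    (Finset.le_sup (f := fun q : R[X] => q.natDegree) hq))

/-- Multi-variable back-and-forth (quantifier elimination). -/
def MvElim (R : Type) [CommRing R] (K : Type) : Prop :=
  ∀ P : Finset (MvPolynomial K R), ∃ Q : Finset R, ∀ a b : R →+* ℝ,
    (∀ q ∈ Q, SignType.sign (a q) = SignType.sign (b q)) →
    ∀ y : K → ℝ, ∃ y' : K → ℝ, ∀ p ∈ P,
      SignType.sign (p.eval₂ a y) = SignType.sign (p.eval₂ b y')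

theorem eval_optionEquivLeft {R : Type} [CommRing R] {K : Type} (a : R →+* ℝ) (y : Option K → ℝ)
    (p : MvPolynomial (Option K) R) :
    ((MvPolynomial.optionEquivLeft R K p).map
      (MvPolynomial.eval₂Hom a (fun k => y (some k)))).eval (y none) = p.eval₂ a y := by
  induction p using MvPolynomial.induction_on with
  | C r => simp
  | add p q hp hq => simp [hp, hq]
  | mul_X p i hp =>
    cases i <;> simp [hp]

theorem mvElim (R : Type) [CommRing R] (K : Type) [Finite K] : MvElim R K := by
  classical
  induction K using Finite.induction_empty_option with
  | of_equiv e h =>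
    intro P
    obtain ⟨Q, hQ⟩ := h (P.image (MvPolynomial.rename e.symm))
    refine ⟨Q, fun a b hab y => ?_⟩
    obtain ⟨y', hy'⟩ := hQ a b hab (fun k => y (e k))
    refine ⟨fun k => y' (e.symm k), fun p hp => ?_⟩
    have := hy' _ (Finset.mem_image_of_mem _ hp)
    rw [MvPolynomial.eval₂_rename, MvPolynomial.eval₂_rename] at this
    have e1 : (fun k => y (e k)) ∘ e.symm = y := by ext k; simp
    rw [e1] at this
    exact this
  | h_empty =>
    intro P
    refine ⟨P.image (fun p => p.coeff 0), fun a b hab y => ⟨y, fun p hp => ?_⟩⟩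
    have h := hab _ (Finset.mem_image_of_mem _ hp)
    rw [MvPolynomial.eq_C_of_isEmpty p]
    simpa using h
  | h_option ih =>
    intro P
    obtain ⟨Q', hQ'⟩ := elim_finset (P.image (MvPolynomial.optionEquivLeft R _))
    obtain ⟨Q, hQ⟩ := ih Q'
    refine ⟨Q, fun a b hab y => ?_⟩
    obtain ⟨y1, hy1⟩ := hQ a b hab (fun k => y (some k))
    obtain ⟨I, hI, h2⟩ := hQ' (MvPolynomial.eval₂Hom a (fun k => y (some k)))
      (MvPolynomial.eval₂Hom b y1) (by intro q hq; simpa using hy1 q hq)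
    obtain ⟨t, ht⟩ := exists_compat hI (y none)
    refine ⟨fun o => o.elim t y1, fun p hp => ?_⟩
    have := h2 _ _ ht _ (Finset.mem_coe.2 (Finset.mem_image_of_mem _ hp))
    rw [eval_optionEquivLeft] at this
    rw [this, ← eval_optionEquivLeft]
    rfl


theorem dotR_add {n : ℕ} (w x y : Fin n → ℝ) : dotR w (x + y) = dotR w x + dotR w y := by
  simp [dotR, mul_add, Finset.sum_add_distrib]
theorem dotR_sub {n : ℕ} (w x y : Fin n → ℝ) : dotR w (x - y) = dotR w x - dotR w y := by
  simp [dotR, mul_sub, Finset.sum_sub_distrib]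
theorem dotR_neg {n : ℕ} (w x : Fin n → ℝ) : dotR w (-x) = - dotR w x := by
  simp [dotR]
theorem dotR_smul {n : ℕ} (w x : Fin n → ℝ) (c : ℝ) : dotR w (c • x) = c * dotR w x := by
  simp only [dotR, Finset.mul_sum, Pi.smul_apply, smul_eq_mul]
  exact Finset.sum_congr rfl (fun i _ => by ring)
theorem dotR_comm {n : ℕ} (w x : Fin n → ℝ) : dotR w x = dotR x w := by
  simp only [dotR]
  exact Finset.sum_congr rfl (fun i _ => by ring)
theorem dotR_sum {n : ℕ} {ι : Type*} (s : Finset ι) (w : Fin n → ℝ) (f : ι → Fin n → ℝ) :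
    dotR w (∑ i ∈ s, f i) = ∑ i ∈ s, dotR w (f i) := by
  simp only [dotR, Finset.sum_apply, Finset.mul_sum]
  exact Finset.sum_comm
theorem neg_dotR {n : ℕ} (w x : Fin n → ℝ) : dotR (-w) x = - dotR w x := by
  simp [dotR]
theorem sub_dotR {n : ℕ} (w x y : Fin n → ℝ) : dotR (w - x) y = dotR w y - dotR x y := by
  rw [dotR_comm, dotR_sub, dotR_comm y, dotR_comm y]

theorem dotR_tendsto {n : ℕ} {α : Type*} {F : Filter α} (w : Fin n → ℝ) {f : α → Fin n → ℝ}
    {x : Fin n → ℝ} (h : Tendsto f F (𝓝 x)) : Tendsto (fun a => dotR w (f a)) F (𝓝 (dotR w x)) := by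
  unfold dotR
  exact tendsto_finsetSum _ (fun i _ => (tendsto_pi_nhds.1 h i).const_mul _)

theorem mPow_eq {n : ℕ} {x : Fin n → ℝ} (hx : ∀ i, 0 < x i) (w : Fin n → ℝ) :
    mPow x w = Real.exp (dotR w (fun i => Real.log (x i))) := by
  unfold mPow dotR
  rw [Real.exp_sum]
  refine Finset.prod_congr rfl (fun i _ => ?_)
  rw [Real.rpow_def_of_pos (hx i), mul_comm]

theorem mPow_tendsto {n : ℕ} {α : Type*} {F : Filter α} (w : Fin n → ℝ) {f : α → Fin n → ℝ}
    {x : Fin n → ℝ} (hx : ∀ i, 0 < x i) (h : Tendsto f F (𝓝 x)) :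
    Tendsto (fun a => mPow (f a) w) F (𝓝 (mPow x w)) := by
  unfold mPow
  exact tendsto_finsetProd _ (fun i _ =>
    (tendsto_pi_nhds.1 h i).rpow_const (Or.inl (hx i).ne'))

def expV {n : ℕ} (y : Fin n → ℝ) : Fin n → ℝ := fun i => Real.exp (y i)

theorem mPow_expV {n : ℕ} (v w : Fin n → ℝ) : mPow (expV v) w = Real.exp (dotR v w) := by
  rw [mPow_eq (x := expV v) (fun i => Real.exp_pos _), dotR_comm]
  simp [expV]

theorem mPow_mul {n : ℕ} (y : Fin n → ℝ) {v : Fin n → ℝ} (hv : ∀ i, 0 < v i) (w : Fin n → ℝ) :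
    mPow (fun i => expV (-y) i * v i) w = Real.exp (-dotR w y) * mPow v w := by
  have : mPow (fun i => expV (-y) i * v i) w = mPow (expV (-y)) w * mPow v w := by
    unfold mPow
    rw [← Finset.prod_mul_distrib]
    exact Finset.prod_congr rfl (fun i _ => Real.mul_rpow (Real.exp_pos _).le (hv i).le)
  rw [this, mPow_expV, dotR_comm, dotR_neg]

abbrev Par (n m : ℕ) : Type := (Fin n → ℝ) × (Fin m → ℝ) × ℝ

/-- some point of `V` is `δ`-close to `u·v₀`. -/
def Sdel {n m : ℕ} (V : Set ((Fin n → ℝ) × (Fin m → ℝ))) (u : Fin n → ℝ) (c : Par n m) : Prop :=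
  ∃ (v : Fin n → ℝ) (z : Fin m → ℝ), (∀ i, |v i - c.1 i| < c.2.2) ∧ (∀ i, |z i - c.2.1 i| < c.2.2) ∧
    (∀ i, 0 < v i) ∧ ((fun i => u i * v i), z) ∈ V

def evU {n m : ℕ} (c : Par n m) (u : Fin n → ℝ) : MvPolynomial (Fin n) (Par n m → ℝ) →+* ℝ :=
  MvPolynomial.eval₂Hom (Pi.evalRingHom (fun _ : Par n m => ℝ) c) u

theorem sign_le {x y : ℝ} (h : SignType.sign x = SignType.sign y) (hx : 0 ≤ x) : 0 ≤ y := by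
  rw [← sign_nonneg_iff] at *
  rwa [← h]

theorem sign_lt {x y : ℝ} (h : SignType.sign x = SignType.sign y) (hx : 0 < x) : 0 < y := by
  rw [← sign_eq_one_iff] at *
  rwa [← h]

theorem Sdel_elim {n m : ℕ} {V : Set ((Fin n → ℝ) × (Fin m → ℝ))}
    (hV : IsClosedSemialgebraicInOrthant n m V) :
    ∃ Q : Finset (MvPolynomial (Fin n) (Par n m → ℝ)), ∀ (u u' : Fin n → ℝ) (c : Par n m),
      (∀ i, 0 < u i) → (∀ i, 0 < u' i) →
      (∀ q ∈ Q, SignType.sign (evU c u q) = SignType.sign (evU c u' q)) →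
      Sdel V u c → Sdel V u' c := by
  classical
  obtain ⟨W, ⟨k, P, rfl⟩, rfl⟩ := hV
  let R := MvPolynomial (Fin n) (Par n m → ℝ)
  let K := Fin n ⊕ Fin m
  let sub : K → MvPolynomial K R := Sum.elim
    (fun i => MvPolynomial.C (MvPolynomial.X i) * MvPolynomial.X (Sum.inl i))
    (fun i => MvPolynomial.X (Sum.inr i))
  let κ : ℝ →+* MvPolynomial K R :=
    (MvPolynomial.C : R →+* MvPolynomial K R).comp
      ((MvPolynomial.C : (Par n m → ℝ) →+* R).comp (Pi.constRingHom (Par n m) ℝ))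
  let cst : (Par n m → ℝ) → MvPolynomial K R := fun f => MvPolynomial.C (MvPolynomial.C f)
  let bd : K → Par n m → ℝ := Sum.elim (fun i c => c.1 i) (fun i c => c.2.1 i)
  let P1 : Finset (MvPolynomial K R) :=
    (Finset.univ.biUnion P).image (fun g => g.eval₂ κ sub)
  let P2 : Finset (MvPolynomial K R) := Finset.univ.image (fun i : K => MvPolynomial.X i)
  let P3 : Finset (MvPolynomial K R) := Finset.univ.image (fun i : K =>
    cst (fun c => c.2.2) - (MvPolynomial.X i - cst (bd i)))
  let P4 : Finset (MvPolynomial K R) := Finset.univ.image (fun i : K =>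
    cst (fun c => c.2.2) + (MvPolynomial.X i - cst (bd i)))
  obtain ⟨Q, hQ⟩ := mvElim R K (P1 ∪ P2 ∪ P3 ∪ P4)
  refine ⟨Q, fun u u' c hu hu' hab hS => ?_⟩
  obtain ⟨v, z, hv, hz, hv0, hV⟩ := hS
  obtain ⟨y', hy'⟩ := hQ (evU c u) (evU c u') hab (Sum.elim v z)
  have hcst : ∀ (u : Fin n → ℝ) (y : K → ℝ) (f : Par n m → ℝ),
      (cst f).eval₂ (evU c u) y = f c := by
    intro u y f
    simp [cst, evU]
  have hX : ∀ i, SignType.sign ((Sum.elim v z : K → ℝ) i) = SignType.sign (y' i) := by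
    intro i
    have := hy' (MvPolynomial.X i) (by simp [P2])
    simpa using this
  have h3 : ∀ i, SignType.sign (c.2.2 - ((Sum.elim v z : K → ℝ) i - bd i c)) =
      SignType.sign (c.2.2 - (y' i - bd i c)) := by
    intro i
    have := hy' (cst (fun c => c.2.2) - (MvPolynomial.X i - cst (bd i)))
      (Finset.mem_union_left _ (Finset.mem_union_right _ (Finset.mem_image_of_mem _ (Finset.mem_univ i))))
    simpa only [MvPolynomial.eval₂_sub, hcst, MvPolynomial.eval₂_X] using this
  have h4 : ∀ i, SignType.sign (c.2.2 + ((Sum.elim v z : K → ℝ) i - bd i c)) =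
      SignType.sign (c.2.2 + (y' i - bd i c)) := by
    intro i
    have := hy' (cst (fun c => c.2.2) + (MvPolynomial.X i - cst (bd i)))
      (Finset.mem_union_right _ (Finset.mem_image_of_mem _ (Finset.mem_univ i)))
    simpa only [MvPolynomial.eval₂_sub, MvPolynomial.eval₂_add, hcst, MvPolynomial.eval₂_X] using this
  have hb : ∀ i, |(Sum.elim v z : K → ℝ) i - bd i c| < c.2.2 → |y' i - bd i c| < c.2.2 := by
    intro i hi
    rw [abs_lt] at hi ⊢
    have e1 := sign_lt (h3 i) (by linarith)
    have e2 := sign_lt (h4 i) (by linarith)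
    constructor <;> linarith
  have hev : ∀ (u : Fin n → ℝ) (y : K → ℝ) (g : MvPolynomial K ℝ),
      (g.eval₂ κ sub).eval₂ (evU c u) y =
        MvPolynomial.eval (Sum.elim (fun i => u i * y (Sum.inl i)) (fun i => y (Sum.inr i))) g := by
    intro u y g
    induction g using MvPolynomial.induction_on with
    | C r => simp [κ, evU]
    | add p q hp hq => rw [MvPolynomial.eval₂_add, MvPolynomial.eval₂_add, hp, hq, map_add]
    | mul_X p i hp =>
      rw [MvPolynomial.eval₂_mul, MvPolynomial.eval₂_mul, hp, map_mul, MvPolynomial.eval₂_X]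
      congr 1
      cases i <;> simp [sub, evU]
  refine ⟨fun i => y' (Sum.inl i), fun i => y' (Sum.inr i), fun i => hb (Sum.inl i) (hv i),
    fun i => hb (Sum.inr i) (hz i), fun i => sign_lt (hX (Sum.inl i)) (hv0 i), ?_, ?_⟩
  · intro i
    exact mul_pos (hu' i) (sign_lt (hX (Sum.inl i)) (hv0 i))
  · have hW := hV.2
    rw [Set.mem_iUnion] at hW ⊢
    obtain ⟨j, hj⟩ := hW
    refine ⟨j, fun g hg => ?_⟩
    have h1 := hj g hg
    have h2 := hy' (g.eval₂ κ sub) (by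
      refine Finset.mem_union_left _ (Finset.mem_union_left _ (Finset.mem_union_left _ ?_))
      exact Finset.mem_image_of_mem _ (Finset.mem_biUnion.2 ⟨j, Finset.mem_univ _, hg⟩))
    rw [hev, hev] at h2
    exact sign_le h2 h1

/-- the points deep in the cone `σ` (inside its span), as seen by the functionals in `Δ` -/
def deepF {n : ℕ} (Δ : Finset (Fin n → ℝ)) (σ : Set (Fin n → ℝ)) : Filter (Fin n → ℝ) :=
  𝓟 {y | ∀ w ∈ perpSet σ, dotR w y = 0} ⊓
    ⨅ θ ∈ {θ | θ ∈ Δ ∧ θ ∈ dualSet σ ∧ θ ∉ perpSet σ}, comap (dotR θ) atTop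

theorem deepF_span {n : ℕ} (Δ : Finset (Fin n → ℝ)) (σ : Set (Fin n → ℝ)) :
    ∀ᶠ y in deepF Δ σ, ∀ w ∈ perpSet σ, dotR w y = 0 :=
  (inf_le_left : deepF Δ σ ≤ _) (mem_principal_self _)

theorem deepF_tendsto {n : ℕ} {Δ : Finset (Fin n → ℝ)} {σ : Set (Fin n → ℝ)} {θ : Fin n → ℝ}
    (h1 : θ ∈ Δ) (h2 : θ ∈ dualSet σ) (h3 : θ ∉ perpSet σ) :
    Tendsto (dotR θ) (deepF Δ σ) atTop := by
  rw [tendsto_iff_comap]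
  refine (inf_le_right : deepF Δ σ ≤ _).trans ?_
  exact iInf₂_le θ ⟨h1, h2, h3⟩

theorem tendsto_deepF {n : ℕ} {Δ : Finset (Fin n → ℝ)} {σ : Set (Fin n → ℝ)} {α : Type*}
    {F : Filter α} {f : α → Fin n → ℝ} (h1 : ∀ᶠ a in F, ∀ w ∈ perpSet σ, dotR w (f a) = 0)
    (h2 : ∀ θ ∈ Δ, θ ∈ dualSet σ → θ ∉ perpSet σ → Tendsto (fun a => dotR θ (f a)) F atTop) :
    Tendsto f F (deepF Δ σ) := by
  unfold deepF
  rw [tendsto_inf, tendsto_principal]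
  refine ⟨h1, ?_⟩
  simp only [tendsto_iInf, tendsto_comap_iff]
  intro θ hθ
  exact h2 θ hθ.1 hθ.2.1 hθ.2.2

def IsInt {n : ℕ} (σ : Set (Fin n → ℝ)) (ξ : Fin n → ℝ) : Prop :=
  ξ ∈ σ ∧ ∀ w ∈ dualSet σ, w ∉ perpSet σ → 0 < dotR w ξ

theorem perp_sub_dual {n : ℕ} {σ : Set (Fin n → ℝ)} {w : Fin n → ℝ} (h : w ∈ perpSet σ) :
    w ∈ dualSet σ := fun x hx => (h x hx).ge

theorem sign_stable {n : ℕ} {Δ : Finset (Fin n → ℝ)} {σ : Set (Fin n → ℝ)} {ξ : Fin n → ℝ}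
    (hξ : IsInt σ ξ) (hΔ : ∀ θ ∈ Δ, θ ∈ dualSet σ ∨ -θ ∈ dualSet σ) {ι : Type*}
    (α : ι → Fin n → ℝ) (c : ι → ℝ) (B : Finset ι) :
    (∀ i ∈ B, ∀ j ∈ B, α i - α j ∈ Δ) →
    ∃ s : SignType, ∀ᶠ y in deepF Δ σ,
      SignType.sign (∑ i ∈ B, c i * Real.exp (-dotR (α i) y)) = s := by
  classical
  induction B using Finset.strongInduction with
  | H B ih =>
    intro hB
    rcases B.eq_empty_or_nonempty with rfl | hne
    · exact ⟨0, by simp⟩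
    obtain ⟨i0, hi0, hmin⟩ := Finset.exists_min_image B (fun i => dotR (α i) ξ) hne
    have hdual : ∀ j ∈ B, α j - α i0 ∈ dualSet σ := by
      intro j hj
      rcases hΔ _ (hB j hj i0 hi0) with h | h
      · exact h
      · by_cases hp : -(α j - α i0) ∈ perpSet σ
        · intro x hx
          have := hp x hx
          rw [neg_dotR] at this
          linarith
        · have h1 := hξ.2 _ h hp
          rw [neg_dotR, sub_dotR] at h1
          have := hmin j hj
          linarith
    set B0 := B.filter (fun j => α j - α i0 ∈ perpSet σ) with hB0
    set B1 := B.filter (fun j => α j - α i0 ∉ perpSet σ) with hB1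
    by_cases hC : ∑ j ∈ B0, c j = 0
    · obtain ⟨s, hs⟩ := ih B1 (by
        refine Finset.ssubset_iff_subset_ne.2 ⟨Finset.filter_subset _ _, fun h => ?_⟩
        have h1 : i0 ∈ B1 := by rw [h]; exact hi0
        refine (Finset.mem_filter.1 h1).2 ?_
        intro x _
        simp [dotR]) (fun i hi j hj => hB i (Finset.mem_filter.1 hi).1 j (Finset.mem_filter.1 hj).1)
      refine ⟨s, ?_⟩
      filter_upwards [hs, deepF_span Δ σ] with y hy hsp
      rw [← Finset.sum_filter_add_sum_filter_not B (fun j => α j - α i0 ∈ perpSet σ)]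
      have : ∑ j ∈ B0, c j * Real.exp (-dotR (α j) y) = 0 := by
        have h1 : ∀ j ∈ B0, c j * Real.exp (-dotR (α j) y) = c j * Real.exp (-dotR (α i0) y) := by
          intro j hj
          have := hsp _ (Finset.mem_filter.1 hj).2
          rw [sub_dotR] at this
          rw [show dotR (α j) y = dotR (α i0) y by linarith]
        rw [Finset.sum_congr rfl h1, ← Finset.sum_mul, hC, zero_mul]
      rw [← hB0, this, zero_add]
      exact hy
    · have hlim : Tendsto (fun y => ∑ j ∈ B, c j * Real.exp (-dotR (α j - α i0) y)) (deepF Δ σ)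
          (𝓝 (∑ j ∈ B0, c j)) := by
        rw [hB0, Finset.sum_filter]
        refine tendsto_finsetSum _ (fun j hj => ?_)
        split_ifs with h
        · refine tendsto_const_nhds.congr' ?_
          filter_upwards [deepF_span Δ σ] with y hy
          rw [hy _ h]; simp
        · have h1 := deepF_tendsto (hB j hj i0 hi0) (hdual j hj) h
          have h2 := (Real.tendsto_exp_neg_atTop_nhds_zero.comp h1).const_mul (c j)
          simpa using h2
      refine ⟨SignType.sign (∑ j ∈ B0, c j), ?_⟩
      have hss : ∀ᶠ y in deepF Δ σ,
          SignType.sign (∑ j ∈ B, c j * Real.exp (-dotR (α j - α i0) y)) =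
            SignType.sign (∑ j ∈ B0, c j) := by
        rcases lt_or_gt_of_ne hC with h | h
        · filter_upwards [hlim.eventually (gt_mem_nhds h)] with y hy
          rw [sign_neg hy, sign_neg h]
        · filter_upwards [hlim.eventually (lt_mem_nhds h)] with y hy
          rw [sign_pos hy, sign_pos h]
      filter_upwards [hss] with y hy
      rw [← hy]
      have : ∑ j ∈ B, c j * Real.exp (-dotR (α j - α i0) y) =
          (∑ j ∈ B, c j * Real.exp (-dotR (α j) y)) * Real.exp (dotR (α i0) y) := by
        rw [Finset.sum_mul]
        refine Finset.sum_congr rfl (fun j _ => ?_)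
        rw [mul_assoc, ← Real.exp_add, sub_dotR]
        congr 2; ring
      rw [this, sign_mul, sign_pos (Real.exp_pos _), mul_one]

/-- key stability property -/
def Stab {n m : ℕ} (V : Set ((Fin n → ℝ) × (Fin m → ℝ))) (Δ : Finset (Fin n → ℝ))
    (σ : Set (Fin n → ℝ)) : Prop :=
  ∀ c : Par n m, (∃ᶠ y in deepF Δ σ, Sdel V (expV (-y)) c) →
    ∀ᶠ y in deepF Δ σ, Sdel V (expV (-y)) c

theorem exists_stab {n m : ℕ} {V : Set ((Fin n → ℝ) × (Fin m → ℝ))}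
    (hV : IsClosedSemialgebraicInOrthant n m V) :
    ∃ Δ : Finset (Fin n → ℝ), ∀ (σ : Set (Fin n → ℝ)) (ξ : Fin n → ℝ), IsInt σ ξ →
      (∀ θ ∈ Δ, θ ∈ dualSet σ ∨ -θ ∈ dualSet σ) → Stab V Δ σ := by
  classical
  obtain ⟨Q, hQ⟩ := Sdel_elim hV
  let al : (Fin n →₀ ℕ) → Fin n → ℝ := fun γ i => (γ i : ℝ)
  refine ⟨Q.biUnion (fun q => (q.support ×ˢ q.support).image (fun x => al x.1 - al x.2)), ?_⟩
  intro σ ξ hξ hΔ c hfr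
  set Δ := Q.biUnion (fun q => (q.support ×ˢ q.support).image (fun x => al x.1 - al x.2)) with hΔd
  have hq : ∀ q ∈ Q, ∃ s : SignType, ∀ᶠ y in deepF Δ σ, SignType.sign (evU c (expV (-y)) q) = s := by
    intro q hq
    obtain ⟨s, hs⟩ := sign_stable hξ hΔ al (fun γ => q.coeff γ c) q.support (by
      intro i hi j hj
      exact Finset.mem_biUnion.2 ⟨q, hq, Finset.mem_image.2 ⟨(i, j),
        Finset.mem_product.2 ⟨hi, hj⟩, rfl⟩⟩)
    refine ⟨s, ?_⟩
    filter_upwards [hs] with y hy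
    rw [← hy]
    congr 1
    simp only [evU, MvPolynomial.coe_eval₂Hom]
    rw [MvPolynomial.eval₂_eq']
    refine Finset.sum_congr rfl (fun γ _ => ?_)
    simp only [Pi.evalRingHom_apply]
    congr 1
    simp only [expV, dotR, al, Pi.neg_apply]
    rw [← Finset.sum_neg_distrib, Real.exp_sum]
    refine Finset.prod_congr rfl (fun i _ => ?_)
    rw [← Real.exp_nat_mul]
    congr 1; ring
  choose! s hs using hq
  have hall : ∀ᶠ y in deepF Δ σ, ∀ q ∈ Q, SignType.sign (evU c (expV (-y)) q) = s q :=
    (Filter.eventually_all_finset Q).2 hs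
  obtain ⟨y0, hy0, hy0'⟩ := (hfr.and_eventually hall).exists
  filter_upwards [hall] with y hy
  exact hQ (expV (-y0)) (expV (-y)) c (fun i => Real.exp_pos _) (fun i => Real.exp_pos _)
    (fun q hq => by rw [hy0' q hq, hy q hq]) hy0

theorem exists_proj {n : ℕ} (τ : Set (Fin n → ℝ)) : ∃ π : (Fin n → ℝ) → (Fin n → ℝ),
    (∀ T, π T ∈ perpSet τ) ∧ ∀ T, ∀ w ∈ perpSet τ, dotR w (T - π T) = 0 := by
  let W : Submodule ℝ (EuclideanSpace ℝ (Fin n)) :=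
    { carrier := {w | w.ofLp ∈ perpSet τ}
      add_mem' := by
        intro a b ha hb x hx
        have h1 := ha x hx
        have h2 := hb x hx
        rw [dotR_comm] at h1 h2 ⊢
        rw [WithLp.ofLp_add, dotR_add, h1, h2, add_zero]
      zero_mem' := by intro x hx; simp [dotR]
      smul_mem' := by
        intro c a ha x hx
        have h1 := ha x hx
        rw [dotR_comm] at h1 ⊢
        rw [WithLp.ofLp_smul, dotR_smul, h1, mul_zero] }
  refine ⟨fun T => (W.starProjection (WithLp.toLp 2 T)).ofLp, fun T => ?_, fun T w hw => ?_⟩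
  · exact Submodule.starProjection_apply_mem W _
  · have h := Submodule.starProjection_inner_eq_zero (K := W) (WithLp.toLp 2 T) (WithLp.toLp 2 w) hw
    rw [PiLp.inner_apply] at h
    rw [← h]
    unfold dotR
    refine Finset.sum_congr rfl (fun i _ => ?_)
    simp

theorem deep_corr {n : ℕ} {Δ : Finset (Fin n → ℝ)} {τ : Set (Fin n → ℝ)}
    {T : ℕ → Fin n → ℝ}
    (h1 : ∀ w ∈ perpSet τ, Tendsto (fun k => dotR w (T k)) atTop (𝓝 0))
    (h2 : ∀ θ ∈ Δ, θ ∈ dualSet τ → θ ∉ perpSet τ →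
      Tendsto (fun k => dotR θ (T k)) atTop atTop) :
    ∃ e : ℕ → Fin n → ℝ, Tendsto e atTop (𝓝 0) ∧
      Tendsto (fun k => T k - e k) atTop (deepF Δ τ) := by
  obtain ⟨π, hπ1, hπ2⟩ := exists_proj τ
  have he : Tendsto (fun k => π (T k)) atTop (𝓝 0) := by
    rw [tendsto_pi_nhds]
    intro i
    have h := h1 _ (hπ1 (Pi.single i 1))
    refine h.congr (fun k => ?_)
    have e1 := hπ2 (T k) _ (hπ1 (Pi.single i 1))
    have e2 := hπ2 (Pi.single i 1) _ (hπ1 (T k))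
    rw [dotR_sub] at e1 e2
    have e3 : dotR (π (T k)) (Pi.single i 1) = π (T k) i := by
      simp [dotR, Pi.single_apply]
    rw [dotR_comm (π (T k)) (π (Pi.single i 1))] at e2
    linarith
  refine ⟨fun k => π (T k), he, tendsto_deepF (Eventually.of_forall fun k w hw => hπ2 _ _ hw) ?_⟩
  intro θ hθ hd hp
  have h3 := dotR_tendsto θ he
  have h4 := (h2 θ hθ hd hp).atTop_add h3.neg
  refine h4.congr (fun k => ?_)
  rw [dotR_sub]; ring

theorem sdel_of_seq {n m : ℕ} {V : Set ((Fin n → ℝ) × (Fin m → ℝ))} {Δ : Finset (Fin n → ℝ)}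
    {τ : Set (Fin n → ℝ)} (hst : Stab V Δ τ) {Y a : ℕ → Fin n → ℝ} {z : ℕ → Fin m → ℝ}
    {v' : Fin n → ℝ} {z0 : Fin m → ℝ} (hY : Tendsto Y atTop (deepF Δ τ))
    (ha : Tendsto a atTop (𝓝 (expV v'))) (ha0 : ∀ k i, 0 < a k i)
    (hz : Tendsto z atTop (𝓝 z0))
    (hV : ∀ k, ((fun i => expV (-(Y k)) i * a k i), z k) ∈ V) :
    ∀ δ > 0, ∀ᶠ y in deepF Δ τ, Sdel V (expV (-y)) (expV v', z0, δ) := by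
  intro δ hδ
  apply hst
  refine hY.frequently (Eventually.frequently ?_)
  have h1 : ∀ᶠ k in atTop, ∀ i, |a k i - expV v' i| < δ := by
    rw [eventually_all]
    intro i
    exact (Metric.tendsto_nhds.1 (tendsto_pi_nhds.1 ha i)) δ hδ
  have h2 : ∀ᶠ k in atTop, ∀ i, |z k i - z0 i| < δ := by
    rw [eventually_all]
    intro i
    exact (Metric.tendsto_nhds.1 (tendsto_pi_nhds.1 hz i)) δ hδ
  filter_upwards [h1, h2] with k hk1 hk2
  exact ⟨a k, z k, hk1, hk2, ha0 k, hV k⟩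

theorem tend_of_abs {n : ℕ} {f : ℕ → Fin n → ℝ} {x : Fin n → ℝ}
    (h : ∀ j i, |f j i - x i| ≤ 1 / ((j : ℝ) + 1)) : Tendsto f atTop (𝓝 x) := by
  rw [tendsto_pi_nhds]
  intro i
  rw [tendsto_iff_norm_sub_tendsto_zero]
  exact squeeze_zero (fun _ => norm_nonneg _) (fun j => h j i) tendsto_one_div_add_atTop_nhds_zero_nat

theorem tend_nat_of_le {k : ℕ → ℕ} (h : ∀ j, j ≤ k j) {c : ℝ} (hc : 0 < c) :
    Tendsto (fun j => Real.exp (-((k j : ℝ) * c))) atTop (𝓝 0) := by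
  refine Real.tendsto_exp_neg_atTop_nhds_zero.comp ?_
  refine Tendsto.atTop_mul_const hc ?_
  exact tendsto_natCast_atTop_atTop.comp (tendsto_atTop_mono h tendsto_id)

theorem limit_iff {n m : ℕ} {V : Set ((Fin n → ℝ) × (Fin m → ℝ))}
    (hVpos : ∀ p ∈ V, ∀ i, 0 < p.1 i) {Δ : Finset (Fin n → ℝ)} {σ' τ : Set (Fin n → ℝ)}
    {ξ : Fin n → ℝ} (hsub : σ' ⊆ τ)
    (hperp : ∀ w ∈ dualSet τ, w ∉ perpSet τ → w ∉ perpSet σ') (hξ : IsInt σ' ξ)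
    (hst : Stab V Δ τ) (φ : ↥(perpSet σ') → ℝ) (v' : Fin n → ℝ) (z0 : Fin m → ℝ)
    (hφ : ∀ w : ↥(perpSet σ'), φ w = Real.exp (dotR v' (w : Fin n → ℝ))) :
    (φ, z0) ∈ limitSet m σ' V ↔
      ∀ δ > 0, ∀ᶠ y in deepF Δ τ, Sdel V (expV (-y)) (expV v', z0, δ) := by
  have hps : ∀ w ∈ perpSet τ, w ∈ perpSet σ' := fun w hw x hx => hw x (hsub hx)
  have hds : ∀ w ∈ dualSet τ, w ∈ dualSet σ' := fun w hw x hx => hw x (hsub hx)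
  constructor
  · rintro ⟨-, u, huV, huz, hu1, hu2⟩
    simp only at huz hu1
    have hpos : ∀ k i, 0 < (u k).1 i := fun k => hVpos _ (huV k)
    let lg : ℕ → Fin n → ℝ := fun k i => Real.log ((u k).1 i)
    have hm : ∀ k w, mPow (u k).1 w = Real.exp (dotR w (lg k)) := fun k w => mPow_eq (hpos k) w
    simp only [hm] at hu1 hu2
    obtain ⟨e, he, hdeep⟩ := deep_corr (Δ := Δ) (τ := τ) (T := fun k => v' - lg k) (by
      intro w hw
      have h := hu1 w (perp_sub_dual (hps w hw)) (hps w hw)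
      rw [hφ] at h
      have h2 := (Real.continuousAt_log (Real.exp_pos _).ne').tendsto.comp h
      simp only [Function.comp_def, Real.log_exp] at h2
      have h3 := h2.const_sub (dotR w v')
      rw [dotR_comm v', sub_self] at h3
      exact h3.congr (fun k => (dotR_sub _ _ _).symm)) (by
      intro θ _ hd hp
      have h := hu2 θ (hds _ hd) (hperp _ hd hp)
      have h2 := Real.tendsto_exp_comp_nhds_zero.1 h
      have h3 := tendsto_const_nhds.add_atTop (C := dotR θ v') (tendsto_neg_atBot_atTop.comp h2)
      refine h3.congr (fun k => ?_)
      rw [dotR_sub]; simp only [Function.comp_apply]; ring)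
    refine sdel_of_seq hst (a := fun k => expV (v' - e k)) (z := fun k => (u k).2) hdeep ?_
      (fun k i => Real.exp_pos _) huz ?_
    · rw [tendsto_pi_nhds]
      intro i
      have h := (tendsto_pi_nhds.1 he i).const_sub (v' i)
      simp only [Pi.zero_apply, sub_zero] at h
      exact (Real.continuous_exp.tendsto _).comp h
    · intro k
      have : (fun i => expV (-(v' - lg k - e k)) i * expV (v' - e k) i) = (u k).1 := by
        funext i
        simp only [expV, ← Real.exp_add, Pi.neg_apply, Pi.sub_apply]
        rw [show -(v' i - lg k i - e k i) + (v' i - e k i) = lg k i by ring]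
        exact Real.exp_log (hpos k i)
      rw [this]
      exact huV k
  · intro h
    have hdeep : Tendsto (fun k : ℕ => (k : ℝ) • ξ) atTop (deepF Δ τ) := by
      refine tendsto_deepF (Eventually.of_forall fun k w hw => ?_) (fun θ _ hd hp => ?_)
      · rw [dotR_smul, hw ξ (hsub hξ.1), mul_zero]
      · have := hξ.2 θ (hds _ hd) (hperp _ hd hp)
        simp only [dotR_smul]
        exact tendsto_natCast_atTop_atTop.atTop_mul_const this
    have hj : ∀ j : ℕ, ∃ k : ℕ, j ≤ k ∧
        Sdel V (expV (-((k : ℝ) • ξ))) (expV v', z0, 1 / ((j : ℝ) + 1)) := by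
      intro j
      exact ((eventually_ge_atTop j).and
        (hdeep.eventually (h _ (Nat.one_div_pos_of_nat)))).exists
    choose k hkj hS using hj
    choose v z hv hz hv0 hV using hS
    have hvl : Tendsto v atTop (𝓝 (expV v')) := tend_of_abs (fun j i => (hv j i).le)
    have hzl : Tendsto z atTop (𝓝 z0) := tend_of_abs (fun j i => (hz j i).le)
    refine ⟨⟨v', hφ⟩, fun j => (fun i => expV (-((k j : ℝ) • ξ)) i * v j i, z j), hV, hzl, ?_, ?_⟩
    · intro w _ hw
      simp only [mPow_mul _ (hv0 _), dotR_smul, hw ξ hξ.1, mul_zero, neg_zero, Real.exp_zero, one_mul]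
      rw [hφ, ← mPow_expV]
      exact mPow_tendsto w (fun i => Real.exp_pos _) hvl
    · intro w hd hp
      simp only [mPow_mul _ (hv0 _), dotR_smul]
      have h1 := (tend_nat_of_le hkj (hξ.2 w hd hp)).mul
        (mPow_tendsto w (fun i => Real.exp_pos _) hvl)
      rwa [zero_mul] at h1

theorem exists_del {n : ℕ} (a : Fin n → ℝ) : ∃ d : ℝ, 0 < d ∧ d ≤ 1 ∧ ∀ i, d * Real.exp (-a i) < 1 := by
  have hS : 0 ≤ ∑ i, Real.exp (-a i) := Finset.sum_nonneg (fun i _ => (Real.exp_pos _).le)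
  refine ⟨1 / (1 + ∑ i, Real.exp (-a i)), by positivity, ?_, fun i => ?_⟩
  · rw [div_le_one (by linarith)]; linarith
  · have := Finset.single_le_sum (fun i _ => (Real.exp_pos (-a i)).le) (Finset.mem_univ i)
    rw [div_mul_eq_mul_div, one_mul, div_lt_one (by linarith)]
    linarith

theorem part_one_sup {n m : ℕ} {V : Set ((Fin n → ℝ) × (Fin m → ℝ))}
    (hVpos : ∀ p ∈ V, ∀ i, 0 < p.1 i) {Δ : Finset (Fin n → ℝ)} {σ τ : Set (Fin n → ℝ)}
    {ξ ξs : Fin n → ℝ} (hsub : σ ⊆ τ) (hξ : IsInt τ ξ) (hξs : IsInt σ ξs)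
    (hst : Stab V Δ τ) (hss : Stab V Δ σ) :
    relLimitSet m σ τ (limitSet m σ V) ⊆ limitSet m τ V := by
  have hps : ∀ w ∈ perpSet τ, w ∈ perpSet σ := fun w hw x hx => hw x (hsub hx)
  have hds : ∀ w ∈ dualSet τ, w ∈ dualSet σ := fun w hw x hx => hw x (hsub hx)
  rintro ⟨φ, z0⟩ ⟨⟨v', hφ⟩, u, huL, huz, hu1, hu2⟩
  simp only at hφ huz hu1
  rw [limit_iff hVpos (le_refl τ) (fun w _ h => h) hξ hst φ v' z0 hφ]
  have hvk : ∀ k, ∃ v : Fin n → ℝ, ∀ w : ↥(perpSet σ), (u k).1 w = Real.exp (dotR v (w : Fin n → ℝ)) :=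
    fun k => (huL k).1
  choose v hv using hvk
  have hne : (deepF Δ σ).NeBot := by
    have : Tendsto (fun k : ℕ => (k : ℝ) • ξs) atTop (deepF Δ σ) := by
      refine tendsto_deepF (Eventually.of_forall fun k w hw => ?_) (fun θ _ hd hp => ?_)
      · rw [dotR_smul, hw ξs hξs.1, mul_zero]
      · simp only [dotR_smul]
        exact tendsto_natCast_atTop_atTop.atTop_mul_const (hξs.2 θ hd hp)
    exact this.neBot
  choose d hd0 hd1 hd using fun k => exists_del (v k)
  have hy : ∀ k : ℕ, ∃ y : Fin n → ℝ, (∀ w ∈ perpSet σ, dotR w y = 0) ∧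
      (∀ θ ∈ Δ, θ ∈ dualSet τ → θ ∉ perpSet σ → (k : ℝ) ≤ dotR θ (v' - v k + y)) ∧
      Sdel V (expV (-y)) (expV (v k), (u k).2, d k * (1 / ((k : ℝ) + 1))) := by
    intro k
    have h1 := (limit_iff hVpos (le_refl σ) (fun w _ h => h) hξs hss (u k).1 (v k) (u k).2 (hv k)).1
      (huL k) _ (mul_pos (hd0 k) (Nat.one_div_pos_of_nat (n := k)))
    have h2 : ∀ᶠ y in deepF Δ σ, ∀ θ ∈ Δ, θ ∈ dualSet τ → θ ∉ perpSet σ →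
        (k : ℝ) ≤ dotR θ (v' - v k + y) := by
      rw [Filter.eventually_all_finset]
      intro θ hθ
      by_cases h3 : θ ∈ dualSet τ ∧ θ ∉ perpSet σ
      · have h4 := (tendsto_const_nhds (x := dotR θ (v' - v k))).add_atTop (deepF_tendsto hθ (hds _ h3.1) h3.2)
        filter_upwards [h4.eventually_ge_atTop (k : ℝ)] with y hy _ _
        rw [dotR_add]; exact hy
      · exact Eventually.of_forall (fun y h5 h6 => absurd ⟨h5, h6⟩ h3)
    exact ((deepF_span Δ σ).and (h2.and h1)).exists
  choose y hy1 hy2 hyS using hy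
  choose a z ha hz ha0 haV using hyS
  simp only at ha hz
  have hk0 : ∀ k : ℕ, 0 ≤ 1 / ((k : ℝ) + 1) := fun k => (Nat.one_div_pos_of_nat).le
  obtain ⟨e, he, hdeep⟩ := deep_corr (Δ := Δ) (τ := τ) (T := fun k => v' - v k + y k) (by
    intro w hw
    have h := hu1 w (perp_sub_dual hw) (hps w hw) hw
    rw [hφ] at h
    simp only [hv] at h
    have h2 := (Real.continuousAt_log (Real.exp_pos _).ne').tendsto.comp h
    simp only [Function.comp_def, Real.log_exp] at h2
    have h3 := h2.const_sub (dotR w v')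
    rw [dotR_comm v', sub_self] at h3
    refine h3.congr (fun k => ?_)
    rw [dotR_add, hy1 k w (hps w hw), dotR_sub, add_zero, dotR_comm (v k)]) (by
    intro θ hθ hd hp
    by_cases hpσ : θ ∈ perpSet σ
    · have h := hu2 θ hd hpσ hp
      simp only [hv] at h
      have h2 := Real.tendsto_exp_comp_nhds_zero.1 h
      have h3 := tendsto_const_nhds.add_atTop (C := dotR θ v') (tendsto_neg_atBot_atTop.comp h2)
      refine h3.congr (fun k => ?_)
      rw [dotR_add, hy1 k θ hpσ, dotR_sub, add_zero, dotR_comm θ (v k)]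
      simp only [Function.comp_apply]; ring
    · exact tendsto_atTop_mono (fun k => hy2 k θ hθ hd hpσ) tendsto_natCast_atTop_atTop)
  refine sdel_of_seq hst (a := fun k i => a k i * Real.exp (-v k i) * Real.exp (v' i - e k i)) (z := z)
    hdeep ?_ (fun k i => mul_pos (mul_pos (ha0 k i) (Real.exp_pos _)) (Real.exp_pos _)) ?_ ?_
  · have h1 : Tendsto (fun k i => a k i * Real.exp (-v k i)) atTop (𝓝 (fun _ : Fin n => (1 : ℝ))) := by
      refine tend_of_abs (fun k i => ?_)
      have e1 : a k i * Real.exp (-v k i) - 1 = (a k i - expV (v k) i) * Real.exp (-v k i) := by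
        rw [sub_mul, expV, ← Real.exp_add, add_neg_cancel, Real.exp_zero]
      rw [e1, abs_mul, abs_of_pos (Real.exp_pos _)]
      calc _ ≤ d k * (1 / ((k : ℝ) + 1)) * Real.exp (-v k i) :=
            mul_le_mul_of_nonneg_right (ha k i).le (Real.exp_pos _).le
        _ = d k * Real.exp (-v k i) * (1 / ((k : ℝ) + 1)) := by ring
        _ ≤ 1 * (1 / ((k : ℝ) + 1)) := mul_le_mul_of_nonneg_right (hd k i).le (hk0 k)
        _ = _ := one_mul _
    rw [tendsto_pi_nhds]
    intro i
    have h := (tendsto_pi_nhds.1 he i).const_sub (v' i)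
    simp only [Pi.zero_apply, sub_zero] at h
    have h2 := (tendsto_pi_nhds.1 h1 i).mul ((Real.continuous_exp.tendsto _).comp h)
    rw [one_mul] at h2
    exact h2
  · have h1 : Tendsto (fun k i => z k i - (u k).2 i) atTop (𝓝 (fun _ : Fin m => (0 : ℝ))) := by
      refine tend_of_abs (fun k i => ?_)
      rw [sub_zero]
      calc _ ≤ d k * (1 / ((k : ℝ) + 1)) := (hz k i).le
        _ ≤ 1 * (1 / ((k : ℝ) + 1)) := mul_le_mul_of_nonneg_right (hd1 k) (hk0 k)
        _ = _ := one_mul _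
    rw [tendsto_pi_nhds]
    intro i
    have h2 := (tendsto_pi_nhds.1 h1 i).add (tendsto_pi_nhds.1 huz i)
    simpa using h2
  · intro k
    have : (fun i => expV (-(v' - v k + y k - e k)) i * (a k i * Real.exp (-v k i) * Real.exp (v' i - e k i)))
        = fun i => expV (-(y k)) i * a k i := by
      funext i
      simp only [expV, Pi.neg_apply, Pi.sub_apply, Pi.add_apply]
      have : Real.exp (-(y k i)) = Real.exp (-(v' i - v k i + y k i - e k i)) *
          (Real.exp (-v k i) * Real.exp (v' i - e k i)) := by
        rw [← Real.exp_add, ← Real.exp_add]; congr 1; ring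
      rw [this]; ring
    rw [this]
    exact haV k

theorem part_one_sub {n m : ℕ} {V : Set ((Fin n → ℝ) × (Fin m → ℝ))}
    (hVpos : ∀ p ∈ V, ∀ i, 0 < p.1 i) {Δ : Finset (Fin n → ℝ)} {σ τ : Set (Fin n → ℝ)}
    {ξ ξs : Fin n → ℝ} (hsub : σ ⊆ τ) (hξ : IsInt τ ξ) (hξs : IsInt σ ξs)
    (hst : Stab V Δ τ) :
    limitSet m τ V ⊆ relLimitSet m σ τ (limitSet m σ V) := by
  have hps : ∀ w ∈ perpSet τ, w ∈ perpSet σ := fun w hw x hx => hw x (hsub hx)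
  have hds : ∀ w ∈ dualSet τ, w ∈ dualSet σ := fun w hw x hx => hw x (hsub hx)
  rintro ⟨φ, z0⟩ hmem
  obtain ⟨v', hφ⟩ := hmem.1
  simp only at hφ
  rw [limit_iff hVpos (le_refl τ) (fun w _ h => h) hξ hst φ v' z0 hφ] at hmem
  obtain ⟨d, hd0, hd1, hd⟩ := exists_del v'
  have hdeep : Tendsto (fun p : ℕ × ℕ => (p.1 : ℝ) • ξ + (p.2 : ℝ) • ξs) (atTop ×ˢ ⊤) (deepF Δ τ) := by
    refine tendsto_deepF (Eventually.of_forall fun k w hw => ?_) (fun θ _ hd hp => ?_)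
    · rw [dotR_add, dotR_smul, dotR_smul, hw ξ hξ.1, hw ξs (hsub hξs.1)]; ring
    · have h1 : Tendsto (fun p : ℕ × ℕ => (p.1 : ℝ) * dotR θ ξ) (atTop ×ˢ ⊤) atTop :=
        (tendsto_natCast_atTop_atTop.comp tendsto_fst).atTop_mul_const (hξ.2 θ hd hp)
      refine tendsto_atTop_mono (fun p => ?_) h1
      rw [dotR_add, dotR_smul, dotR_smul]
      have := mul_nonneg (Nat.cast_nonneg (α := ℝ) p.2) (hd ξs (hsub hξs.1))
      linarith
  have hj : ∀ j : ℕ, ∃ k : ℕ, j ≤ k ∧ ∀ t : ℕ,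
      Sdel V (expV (-((k : ℝ) • ξ + (t : ℝ) • ξs))) (expV v', z0, d * (1 / ((j : ℝ) + 1))) := by
    intro j
    have h1 := hdeep.eventually (hmem _ (mul_pos hd0 (Nat.one_div_pos_of_nat (n := j))))
    have h2 := Filter.mem_prod_top.1 h1
    exact ((eventually_ge_atTop j).and h2).exists
  choose k hkj hS using hj
  choose a z ha hz ha0 haV using hS
  simp only at ha hz
  have hlim : ∀ j : ℕ, ∃ (b : Fin n → ℝ) (y : Fin m → ℝ) (g : ℕ → ℕ), StrictMono g ∧
      Tendsto (fun t => a j (g t)) atTop (𝓝 b) ∧ Tendsto (fun t => z j (g t)) atTop (𝓝 y) ∧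
      (∀ i, |b i - expV v' i| ≤ d * (1 / ((j : ℝ) + 1))) ∧
      (∀ i, |y i - z0 i| ≤ d * (1 / ((j : ℝ) + 1))) := by
    intro j
    have hD : 0 ≤ d * (1 / ((j : ℝ) + 1)) := (mul_pos hd0 (Nat.one_div_pos_of_nat (n := j))).le
    have hc := (isCompact_closedBall (expV v') (d * (1 / ((j : ℝ) + 1)))).prod
      (isCompact_closedBall z0 (d * (1 / ((j : ℝ) + 1))))
    obtain ⟨⟨b, y⟩, hby, g, hg, hT⟩ := hc.tendsto_subseq (x := fun t => (a j t, z j t)) (by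
      intro t
      refine ⟨?_, ?_⟩
      · rw [Metric.mem_closedBall, dist_pi_le_iff hD]
        exact fun i => (ha j t i).le
      · rw [Metric.mem_closedBall, dist_pi_le_iff hD]
        exact fun i => (hz j t i).le)
    have hb := hby.1
    have hy := hby.2
    rw [Metric.mem_closedBall, dist_pi_le_iff hD] at hb hy
    exact ⟨b, y, g, hg, (continuous_fst.tendsto _).comp hT, (continuous_snd.tendsto _).comp hT, hb, hy⟩
  choose b y g hg hbl hyl hb hy using hlim
  have hk0 : ∀ k : ℕ, 0 ≤ 1 / ((k : ℝ) + 1) := fun k => (Nat.one_div_pos_of_nat).le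
  have hle : ∀ j : ℕ, d * (1 / ((j : ℝ) + 1)) ≤ 1 / ((j : ℝ) + 1) := fun j =>
    mul_le_of_le_one_left (hk0 j) hd1
  have hle2 : ∀ j : ℕ, d * (1 / ((j : ℝ) + 1)) ≤ d := fun j => by
    refine mul_le_of_le_one_right hd0.le ?_
    rw [div_le_one (by positivity)]
    have : (0 : ℝ) ≤ j := Nat.cast_nonneg j
    linarith
  have hb0 : ∀ j i, 0 < b j i := by
    intro j i
    have h1 := (abs_le.1 ((hb j i).trans (hle2 j))).1
    have h2 := hd i
    rw [Real.exp_neg, ← div_eq_mul_inv, div_lt_one (Real.exp_pos _)] at h2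
    simp only [expV] at h1
    linarith
  have hbT : Tendsto b atTop (𝓝 (expV v')) := tend_of_abs (fun j i => (hb j i).trans (hle j))
  have hyT : Tendsto y atTop (𝓝 z0) := tend_of_abs (fun j i => (hy j i).trans (hle j))
  let ν : ℕ → Fin n → ℝ := fun j => (fun i => Real.log (b j i)) - (k j : ℝ) • ξ
  have hν : ∀ j w, Real.exp (dotR (ν j) w) = Real.exp (-((k j : ℝ) * dotR w ξ)) * mPow (b j) w := by
    intro j w
    rw [mPow_eq (hb0 j), ← Real.exp_add, dotR_comm, dotR_sub, dotR_smul]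
    congr 1; ring
  refine ⟨⟨v', hφ⟩, fun j => (fun w => Real.exp (dotR (ν j) (w : Fin n → ℝ)), y j), ?_, hyT, ?_, ?_⟩
  · intro j
    refine ⟨⟨ν j, fun w => rfl⟩, fun t =>
      (fun i => expV (-((k j : ℝ) • ξ + (g j t : ℝ) • ξs)) i * a j (g j t) i, z j (g j t)),
      fun t => haV j (g j t), hyl j, ?_, ?_⟩
    · intro w _ hw
      simp only [hν, mPow_mul _ (ha0 _ _), dotR_add, dotR_smul, hw ξs hξs.1, mul_zero, add_zero]
      exact (mPow_tendsto w (hb0 j) (hbl j)).const_mul _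
    · intro w hd hp
      simp only [mPow_mul _ (ha0 _ _), dotR_add, dotR_smul]
      simp only [neg_add, Real.exp_add]
      have h1 := ((tend_nat_of_le (hg j).id_le (hξs.2 w hd hp)).const_mul
        (Real.exp (-((k j : ℝ) * dotR w ξ)))).mul (mPow_tendsto w (hb0 j) (hbl j))
      simpa using h1
  · intro w _ hwσ hwτ
    simp only [hν, hφ, hwτ ξ hξ.1, mul_zero, neg_zero, Real.exp_zero, one_mul]
    rw [← mPow_expV]
    exact mPow_tendsto w (fun i => Real.exp_pos _) hbT
  · intro w hd hwσ hp
    simp only [hν]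
    have h1 := (tend_nat_of_le hkj (hξ.2 w hd hp)).mul
        (mPow_tendsto w (fun i => Real.exp_pos _) hbT)
    rwa [zero_mul] at h1

theorem relint_perp {n : ℕ} {C : Set (Fin n → ℝ)} {ξ w : Fin n → ℝ}
    (hξ : ξ ∈ intrinsicInterior ℝ C) (hw : w ∈ dualSet C) (h0 : dotR w ξ = 0) : w ∈ perpSet C := by
  intro x hx
  obtain ⟨y, hy, rfl⟩ := mem_intrinsicInterior.1 hξ
  have hxs : x ∈ affineSpan ℝ C := subset_affineSpan ℝ C hx
  let f : ℝ → affineSpan ℝ C := fun t =>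
    ⟨AffineMap.lineMap (y : Fin n → ℝ) x (-t), AffineMap.lineMap_mem _ y.2 hxs⟩
  have hf : Continuous f := by
    refine Continuous.subtype_mk ?_ _
    exact AffineMap.lineMap_continuous.comp continuous_neg
  have hf0 : f 0 = y := by
    apply Subtype.ext
    simp [f]
  have hmem : ∀ᶠ t in 𝓝 (0 : ℝ), f t ∈ interior ((↑) ⁻¹' C : Set (affineSpan ℝ C)) :=
    hf.tendsto 0 (by rw [hf0]; exact isOpen_interior.mem_nhds hy)
  obtain ⟨t, ht, ht0⟩ := ((hmem.filter_mono nhdsWithin_le_nhds).and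
    (self_mem_nhdsWithin : Set.Ioi (0 : ℝ) ∈ 𝓝[>] (0 : ℝ))).exists
  have hC : (f t : Fin n → ℝ) ∈ C :=
    (interior_subset ht : f t ∈ ((↑) ⁻¹' C : Set (affineSpan ℝ C)))
  have h1 := hw _ hC
  simp only [f, AffineMap.lineMap_apply, vsub_eq_sub, vadd_eq_add] at h1
  rw [dotR_add, dotR_smul, dotR_sub, h0] at h1
  have h2 := hw x hx
  have ht0' : 0 < t := ht0
  nlinarith

theorem eps_sign (N : ℕ) : ∀ t : ℕ → ℝ, ∀ᶠ e in 𝓝[>] (0 : ℝ),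
    (∀ k ≤ N, 0 ≤ ∑ i ∈ Finset.range k, e ^ i * t i) ∨
    (∀ k ≤ N, ∑ i ∈ Finset.range k, e ^ i * t i ≤ 0) := by
  induction N with
  | zero =>
    intro t
    refine Eventually.of_forall (fun e => Or.inl (fun k hk => ?_))
    rw [Nat.le_zero.1 hk]; simp
  | succ N ih =>
    intro t
    have hstep : ∀ (e : ℝ) (k : ℕ), ∑ i ∈ Finset.range (k + 1), e ^ i * t i =
        t 0 + e * ∑ i ∈ Finset.range k, e ^ i * t (i + 1) := by
      intro e k
      rw [Finset.sum_range_succ', Finset.mul_sum, add_comm]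
      congr 1
      · simp
      · exact Finset.sum_congr rfl (fun i _ => by ring)
    have hlim : ∀ k : ℕ, Tendsto (fun e : ℝ => ∑ i ∈ Finset.range (k + 1), e ^ i * t i) (𝓝[>] 0)
        (𝓝 (t 0)) := by
      intro k
      have hc : Continuous (fun e : ℝ => ∑ i ∈ Finset.range (k + 1), e ^ i * t i) := by fun_prop
      have := hc.tendsto 0
      rw [hstep 0 k, zero_mul, add_zero] at this
      exact this.mono_left nhdsWithin_le_nhds
    rcases lt_trichotomy (t 0) 0 with h | h | h
    · have : ∀ᶠ e in 𝓝[>] (0 : ℝ), ∀ k ∈ Finset.range (N + 1),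
          ∑ i ∈ Finset.range (k + 1), e ^ i * t i < 0 :=
        (Filter.eventually_all_finset _).2 (fun k _ => (hlim k).eventually (gt_mem_nhds h))
      filter_upwards [this] with e he
      refine Or.inr (fun k hk => ?_)
      cases k with
      | zero => simp
      | succ k => exact (he k (by simp; omega)).le
    · filter_upwards [ih (fun i => t (i + 1)), self_mem_nhdsWithin] with e he he0
      have he0' : 0 < e := he0
      refine he.imp (fun H k hk => ?_) (fun H k hk => ?_)
      · cases k with
        | zero => simp
        | succ k =>
          rw [hstep, h, zero_add]
          exact mul_nonneg he0'.le (H k (by omega))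
      · cases k with
        | zero => simp
        | succ k =>
          rw [hstep, h, zero_add]
          exact mul_nonpos_of_nonneg_of_nonpos he0'.le (H k (by omega))
    · have : ∀ᶠ e in 𝓝[>] (0 : ℝ), ∀ k ∈ Finset.range (N + 1),
          0 < ∑ i ∈ Finset.range (k + 1), e ^ i * t i :=
        (Filter.eventually_all_finset _).2 (fun k _ => (hlim k).eventually (lt_mem_nhds h))
      filter_upwards [this] with e he
      refine Or.inl (fun k hk => ?_)
      cases k with
      | zero => simp
      | succ k => exact (he k (by simp; omega)).le

theorem dot_wVec {n : ℕ} (l : ℕ → Fin n → ℝ) (e : ℝ) (θ : Fin n → ℝ) (k : ℕ) (hk : 1 ≤ k) :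
    dotR θ (wVec l (fun _ => e) k) = ∑ i ∈ Finset.range k, e ^ i * dotR θ (l (i + 1)) := by
  induction k, hk using Nat.le_induction with
  | base => simp [wVec]
  | succ k hk ih =>
    rw [Finset.sum_range_succ, ← ih]
    simp only [wVec]
    rw [← Finset.insert_Icc_right_eq_Icc_add_one (by omega), Finset.sum_insert (by simp)]
    simp only [Finset.prod_const, Nat.card_Icc, dotR_add, dotR_smul]
    rw [show k + 1 + 1 - 2 = k by omega]
    ring

theorem coneSigma_dual {n : ℕ} {l : ℕ → Fin n → ℝ} {ε : ℕ → ℝ} {r : ℕ} {θ : Fin n → ℝ}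
    (h : ∀ k, 1 ≤ k → k ≤ r → 0 ≤ dotR θ (wVec l ε k)) : θ ∈ dualSet (coneSigma n l ε r) := by
  rintro x ⟨lam, hlam, rfl⟩
  rw [dotR_sum]
  refine Finset.sum_nonneg (fun k hk => ?_)
  rw [dotR_smul]
  rw [Finset.mem_Icc] at hk
  exact mul_nonneg (hlam k) (h k hk.1 hk.2)

theorem wVec_mem {n : ℕ} {l : ℕ → Fin n → ℝ} {ε : ℕ → ℝ} {r k : ℕ} (h1 : 1 ≤ k) (h2 : k ≤ r) :
    wVec l ε k ∈ coneSigma n l ε r := by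
  refine ⟨fun j => if j = k then 1 else 0, fun j => by beta_reduce; split_ifs <;> norm_num, ?_⟩
  simp only [ite_smul, one_smul, zero_smul]
  rw [Finset.sum_ite_eq' (Finset.Icc 1 r) k, if_pos (Finset.mem_Icc.2 ⟨h1, h2⟩)]

theorem coneSigma_int {n : ℕ} (l : ℕ → Fin n → ℝ) (ε : ℕ → ℝ) (r : ℕ) :
    IsInt (coneSigma n l ε r) (∑ k ∈ Finset.Icc 1 r, wVec l ε k) := by
  refine ⟨⟨fun _ => 1, fun _ => zero_le_one, by simp⟩, fun w hw hp => ?_⟩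
  rw [dotR_sum]
  have hnn : ∀ k ∈ Finset.Icc 1 r, 0 ≤ dotR w (wVec l ε k) := fun k hk =>
    hw _ (wVec_mem (Finset.mem_Icc.1 hk).1 (Finset.mem_Icc.1 hk).2)
  refine lt_of_le_of_ne (Finset.sum_nonneg hnn) (fun h => hp ?_)
  have h0 := (Finset.sum_eq_zero_iff_of_nonneg hnn).1 h.symm
  rintro x ⟨lam, -, rfl⟩
  rw [dotR_sum]
  refine Finset.sum_eq_zero (fun k hk => ?_)
  rw [dotR_smul, h0 k hk, mul_zero]

theorem coneSigma_mono {n : ℕ} (l : ℕ → Fin n → ℝ) (ε : ℕ → ℝ) {s r : ℕ} (h : s ≤ r) :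
    coneSigma n l ε s ⊆ coneSigma n l ε r := by
  rintro x ⟨lam, hlam, rfl⟩
  refine ⟨fun k => if k ≤ s then lam k else 0, fun k => by beta_reduce; split_ifs; exacts [hlam k, le_rfl], ?_⟩
  have hsub : Finset.Icc 1 s ⊆ Finset.Icc 1 r := Finset.Icc_subset_Icc_right h
  rw [← Finset.sum_subset hsub]
  · refine Finset.sum_congr rfl (fun k hk => ?_)
    beta_reduce
    rw [if_pos (Finset.mem_Icc.1 hk).2]
  · intro k hk hk'
    rw [Finset.mem_Icc] at hk hk'
    beta_reduce
    rw [if_neg (by omega), zero_smul]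

theorem part_two {n m : ℕ} {V : Set ((Fin n → ℝ) × (Fin m → ℝ))}
    (hVpos : ∀ p ∈ V, ∀ i, 0 < p.1 i) {Δ : Finset (Fin n → ℝ)} {σ' τ : Set (Fin n → ℝ)}
    {ξ : Fin n → ℝ} (hξ : IsInt τ ξ) (hst : Stab V Δ τ) (hsc : IsSCCone σ') (hsub : σ' ⊆ τ)
    (hri : intrinsicInterior ℝ σ' ⊆ intrinsicInterior ℝ τ) :
    limitSet m σ' V =
          {p : (↥(perpSet σ') → ℝ) × (Fin m → ℝ) | p.1 ∈ orbitSet σ'} ∩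
            (fun p : (↥(perpSet σ') → ℝ) × (Fin m → ℝ) =>
              (restrictOrbit σ' τ hsub p.1, p.2)) ⁻¹' limitSet m τ V := by
  obtain ⟨-, hconv, h0, -, -⟩ := hsc
  obtain ⟨η, hη⟩ := (Set.Nonempty.intrinsicInterior hconv ⟨0, h0⟩ : (intrinsicInterior ℝ σ').Nonempty)
  have hηm : η ∈ σ' := intrinsicInterior_subset hη
  have hint : IsInt σ' η := by
    refine ⟨hηm, fun w hw hp => lt_of_le_of_ne (hw η hηm) (fun h => hp ?_)⟩
    exact relint_perp hη hw h.symm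
  have hperp : ∀ w ∈ dualSet τ, w ∉ perpSet τ → w ∉ perpSet σ' := fun w hw hp hp' =>
    hp (relint_perp (hri hη) hw (hp' η hηm))
  ext ⟨φ, z⟩
  constructor
  · intro h
    obtain ⟨v', hφ⟩ := h.1
    refine ⟨h.1, ?_⟩
    rw [limit_iff hVpos hsub hperp hint hst φ v' z hφ] at h
    exact (limit_iff hVpos (le_refl τ) (fun w _ h => h) hξ hst _ v' z (fun w => hφ _)).2 h
  · rintro ⟨⟨v', hφ⟩, h⟩
    rw [limit_iff hVpos hsub hperp hint hst φ v' z hφ]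
    exact (limit_iff hVpos (le_refl τ) (fun w _ h => h) hξ hst _ v' z (fun w => hφ _)).1 h


/-- Let `l₁, …, l_n` be `ℝ`-linearly independent vectors in `ℝ^n` and let
`V ⊆ ℝ_{>0}^n × ℝ^m` be a closed semialgebraic set. Then there exist (sufficiently small)
`ε₂, …, ε_n > 0` such that, with `σ_r` the cone spanned by `w_1, …, w_r`:
(1) for all `1 ≤ s ≤ r ≤ n`, `L_{σ_r}(V) = L_{σ_s,σ_r}(L_{σ_s}(V))`; and
(2) for all `1 ≤ r ≤ n` and every strongly convex cone `σ' ⊆ σ_r` with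
`relint σ' ⊆ relint σ_r`, `L_{σ'}(V)` is the preimage of `L_{σ_r}(V)` inside
`O(σ')(ℝ_{>0}) × ℝ^m` under `ρ_{σ',σ_r} × id`. -/
theorem stmt_4 (n m : ℕ) (hn : 1 ≤ n) (l : ℕ → Fin n → ℝ)
    (hl : LinearIndependent ℝ (fun i : Fin n => l ((i : ℕ) + 1)))
    (V : Set ((Fin n → ℝ) × (Fin m → ℝ)))
    (hV : IsClosedSemialgebraicInOrthant n m V) :
    ∃ ε : ℕ → ℝ, (∀ j, 2 ≤ j → j ≤ n → 0 < ε j) ∧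
      (∀ s r, 1 ≤ s → s ≤ r → r ≤ n →
        limitSet m (coneSigma n l ε r) V =
          relLimitSet m (coneSigma n l ε s) (coneSigma n l ε r)
            (limitSet m (coneSigma n l ε s) V)) ∧
      (∀ r, 1 ≤ r → r ≤ n → ∀ σ' : Set (Fin n → ℝ), IsSCCone σ' →
        ∀ hsub : σ' ⊆ coneSigma n l ε r,
        intrinsicInterior ℝ σ' ⊆ intrinsicInterior ℝ (coneSigma n l ε r) →
        limitSet m σ' V =
          {p : (↥(perpSet σ') → ℝ) × (Fin m → ℝ) | p.1 ∈ orbitSet σ'} ∩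
            (fun p : (↥(perpSet σ') → ℝ) × (Fin m → ℝ) =>
              (restrictOrbit σ' (coneSigma n l ε r) hsub p.1, p.2)) ⁻¹'
              limitSet m (coneSigma n l ε r) V) := by
  have hVpos : ∀ p ∈ V, ∀ i, 0 < p.1 i := by
    obtain ⟨W, -, rfl⟩ := hV
    exact fun p hp => hp.1
  obtain ⟨Δ, hΔ⟩ := exists_stab hV
  have hev : ∀ᶠ e in 𝓝[>] (0 : ℝ), ∀ θ ∈ Δ,
      (∀ k ≤ n, 0 ≤ ∑ i ∈ Finset.range k, e ^ i * dotR θ (l (i + 1))) ∨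
      (∀ k ≤ n, ∑ i ∈ Finset.range k, e ^ i * dotR θ (l (i + 1)) ≤ 0) :=
    (Filter.eventually_all_finset Δ).2 (fun θ _ => eps_sign n (fun i => dotR θ (l (i + 1))))
  obtain ⟨e, he, he0⟩ := (hev.and
    (self_mem_nhdsWithin : Set.Ioi (0 : ℝ) ∈ 𝓝[>] (0 : ℝ))).exists
  have he0' : 0 < e := he0
  have hst : ∀ r, r ≤ n → Stab V Δ (coneSigma n l (fun _ => e) r) := by
    intro r hr
    refine hΔ _ _ (coneSigma_int l (fun _ => e) r) (fun θ hθ => ?_)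
    refine (he θ hθ).imp (fun H => ?_) (fun H => ?_)
    · refine coneSigma_dual (fun k hk1 hk2 => ?_)
      rw [dot_wVec l e θ k hk1]
      exact H k (hk2.trans hr)
    · refine coneSigma_dual (fun k hk1 hk2 => ?_)
      rw [neg_dotR, dot_wVec l e θ k hk1]
      have := H k (hk2.trans hr)
      linarith
  refine ⟨fun _ => e, fun _ _ _ => he0', ?_, ?_⟩
  · intro s r _ hsr hrn
    apply Set.Subset.antisymm
    · exact part_one_sub hVpos (coneSigma_mono l _ hsr) (coneSigma_int l _ r) (coneSigma_int l _ s)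
        (hst r hrn)
    · exact part_one_sup hVpos (coneSigma_mono l _ hsr) (coneSigma_int l _ r) (coneSigma_int l _ s)
        (hst r hrn) (hst s (hsr.trans hrn))
  · intro r _ hrn σ' hsc hsub hri
    exact part_two hVpos (coneSigma_int l _ r) (hst r hrn) hsc hsub hri
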